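/- arXiv:math/9310228 — 3 statements merged into one kernel-verified Lean document; each statement's English description precedes it below -/
import Mathlib

section
/- (KKM theorem) Let Δ be the standard n-simplex in ℝ^{n+1} with vertices e₀, …, e_n, and let C₀, …, C_n be closed subsets of Δ such that for every nonempty subset θ ⊆ {0, …, n}, the face of Δ spanned by {e_i : i ∈ θ} is contained in ⋃_{i∈θ} C_i. Then ⋂_{i=0}^n C_i ≠ ∅. -/
section Dominant

variable {V ι α : Type*} [LinearOrder α]

/-- A finite set `S` is dominant for the family `f` of rankings if no point
exceeds, in every ranking, the minimum of that ranking on `S`. -/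
def IsDominant (f : ι → V → α) (S : Finset V) : Prop :=
  ∀ y, ∃ i, ∀ x ∈ S, f i y ≤ f i x

theorem IsDominant.mono {f : ι → V → α} {R S : Finset V} (hS : IsDominant f S) (h : R ⊆ S) :
    IsDominant f R := fun y =>
  let ⟨i, hi⟩ := hS y
  ⟨i, fun x hx => hi x (h hx)⟩

variable [DecidableEq V]

/-- If the minimizers `μ i`, `i ≠ a`, enumerate `R`, then adjoining a point maximal in the
ranking `a` among those above all `μ i`, `i ≠ a`, keeps `R` dominant. -/
theorem IsDominant.insert_of_isMax {f : ι → V → α} {R : Finset V} (hR : IsDominant f R)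
    {μ : ι → V} (hμR : ∀ i, μ i ∈ R) (hμ : ∀ i, ∀ x ∈ R, f i (μ i) ≤ f i x) {a : ι} {y : V}
    (hy : ∀ i, i ≠ a → f i (μ i) < f i y)
    (hmax : ∀ z, (∀ i, i ≠ a → f i (μ i) < f i z) → f a z ≤ f a y) :
    IsDominant f (insert y R) := by
  intro z
  have hya : f a y ≤ f a (μ a) := by
    obtain ⟨i, hi⟩ := hR y
    by_cases h : i = a
    · subst h; exact hi _ (hμR _)
    · exact absurd (hi _ (hμR i)) (not_le.2 (hy i h))
  by_cases hz : ∀ i, i ≠ a → f i (μ i) < f i z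
  · refine ⟨a, fun x hx => ?_⟩
    rcases Finset.mem_insert.1 hx with rfl | hx
    · exact hmax z hz
    · exact (hmax z hz).trans (hya.trans (hμ a x hx))
  · push Not at hz
    obtain ⟨i, hia, hi⟩ := hz
    refine ⟨i, fun x hx => ?_⟩
    rcases Finset.mem_insert.1 hx with rfl | hx
    · exact hi.trans (hy i hia).le
    · exact hi.trans (hμ i x hx)

/-- A dominant set with one element fewer than there are rankings extends in exactly two ways
to a dominant set with one more element, provided it can be extended in every direction. -/
theorem IsDominant.card_extensions [Fintype V] [Fintype ι] [DecidableEq ι] {f : ι → V → α}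
    (hf : ∀ i, Function.Injective (f i)) {R : Finset V} (hR : IsDominant f R)
    (hcard : R.card + 1 = Fintype.card ι) (hne : R.Nonempty)
    (hext : ∀ e, ∃ v, ∀ i, i ≠ e → ∃ x ∈ R, f i x < f i v) (rooms : Finset (Finset V))
    (hrooms : ∀ S, S ∈ rooms ↔ IsDominant f S ∧ S.card = Fintype.card ι ∧ R ⊆ S) :
    rooms.card = 2 := by
  choose μ hμR hμ using fun i => R.exists_min_image (f i) hne
  have hμeq : ∀ i, ∀ x ∈ R, (∀ y ∈ R, f i x ≤ f i y) → μ i = x := fun i x hx h =>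
    hf i (le_antisymm (hμ i x hx) (h _ (hμR i)))
  have hsurj : ∀ x ∈ R, ∃ i, μ i = x := fun x hx =>
    let ⟨i, hi⟩ := hR x
    ⟨i, hμeq i x hx hi⟩
  obtain ⟨a, -, b, -, hab, hμab⟩ := Finset.exists_ne_map_eq_of_card_lt_of_maps_to
    (s := Finset.univ) (t := R) (f := μ) (by rw [Finset.card_univ]; omega) (fun i _ => hμR i)
  have hinj : ∀ a b : ι, a ≠ b → μ a = μ b → ∀ i j, i ≠ a → j ≠ a → μ i = μ j → i = j := by
    intro a b hab hμab i j hi hj hij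
    have himg : (Finset.univ.erase a).image μ = R := by
      ext x
      simp only [Finset.mem_image, Finset.mem_erase, Finset.mem_univ, and_true]
      constructor
      · rintro ⟨i, -, rfl⟩; exact hμR i
      · intro hx
        obtain ⟨i, rfl⟩ := hsurj x hx
        by_cases h : i = a
        · exact ⟨b, hab.symm, by rw [h, hμab]⟩
        · exact ⟨i, h, rfl⟩
    have hc : ((Finset.univ.erase a).image μ).card = (Finset.univ.erase a).card := by
      rw [himg, Finset.card_erase_of_mem (Finset.mem_univ _), Finset.card_univ]; omega
    exact Finset.card_image_iff.1 hc (by simpa using hi) (by simpa using hj) hij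
  have hinja := hinj a b hab hμab
  have hinjb := hinj b a hab.symm hμab.symm
  have hmax : ∀ e, ∃ y, (∀ i, i ≠ e → f i (μ i) < f i y) ∧
      ∀ z, (∀ i, i ≠ e → f i (μ i) < f i z) → f e z ≤ f e y := by
    intro e
    classical
    obtain ⟨v, hv⟩ := hext e
    obtain ⟨y, hy, hy'⟩ := (Finset.univ.filter
      fun y => ∀ i, i ≠ e → f i (μ i) < f i y).exists_max_image (f e) ⟨v, by
        simp only [Finset.mem_filter, Finset.mem_univ, true_and]
        intro i hi
        obtain ⟨x, hx, hlt⟩ := hv i hi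
        exact (hμ i x hx).trans_lt hlt⟩
    simp only [Finset.mem_filter, Finset.mem_univ, true_and] at hy hy'
    exact ⟨y, hy, hy'⟩
  choose y hy hymax using hmax
  have hynot : ∀ e e', e ≠ e' → μ e = μ e' → y e ∉ R := by
    intro e e' hee he hyR
    obtain ⟨i, hi⟩ := hsurj _ hyR
    by_cases h : i = e
    · subst h
      exact (hy i e' hee.symm).ne (by rw [← he, hi])
    · exact (hy e i h).ne (by rw [hi])
  have hya := hynot a b hab hμab
  have hyb := hynot b a hab.symm hμab.symm
  have hyab : y a ≠ y b := by
    intro h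
    obtain ⟨i, hi⟩ := hR (y a)
    by_cases hia : i = a
    · subst hia
      exact (hy b i hab).not_ge (h ▸ hi _ (hμR _))
    · exact (hy a i hia).not_ge (hi _ (hμR _))
  have key : rooms = {insert (y a) R, insert (y b) R} := by
    ext S
    rw [hrooms]
    simp only [Finset.mem_insert, Finset.mem_singleton]
    constructor
    · rintro ⟨hS, hSc, hRS⟩
      obtain ⟨v, hvR, rfl⟩ : ∃ v, v ∉ R ∧ insert v R = S :=
        Finset.exists_eq_insert_iff.2 ⟨hRS, by omega⟩
      obtain ⟨e, he⟩ := hS v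
      have hother : ∀ x ∈ R, ∃ i, i ≠ e ∧ μ i = x ∧ f i x < f i v := by
        intro x hx
        have hxv : x ≠ v := fun h => hvR (h ▸ hx)
        obtain ⟨i, hi⟩ := hS x
        have hlt : f i x < f i v := lt_of_le_of_ne (hi v (by simp)) ((hf i).ne hxv)
        refine ⟨i, ?_, hμeq i x hx fun z hz => hi z (by simp [hz]), hlt⟩
        rintro rfl
        exact hlt.not_ge (he x (by simp [hx]))
      have hv_eq : (∀ i j, i ≠ e → j ≠ e → μ i = μ j → i = j) → v = y e := by
        intro hinje
        have hvM : ∀ i, i ≠ e → f i (μ i) < f i v := by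
          intro i hi
          obtain ⟨j, hj, hji, hlt⟩ := hother _ (hμR i)
          have := hinje j i hj hi hji
          subst this
          exact hlt
        refine hf e (le_antisymm (hymax e v hvM) ?_)
        obtain ⟨i, hi⟩ := hS (y e)
        by_cases h : i = e
        · subst h; exact hi v (by simp)
        · exact absurd (hi _ (Finset.mem_insert_of_mem (hμR i))) (not_le.2 (hy e i h))
      have heab : e = a ∨ e = b := by
        obtain ⟨j, hj, hje, -⟩ := hother _ (hμR e)
        by_contra! hcon
        by_cases hja : j = a
        · exact hj (hinjb j e (hja ▸ hab) hcon.2 hje)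
        · exact hj (hinja j e hja hcon.1 hje)
      rcases heab with rfl | rfl
      · left; rw [hv_eq hinja]
      · right; rw [hv_eq hinjb]
    · rintro (rfl | rfl)
      · exact ⟨hR.insert_of_isMax hμR hμ (hy a) (hymax a),
          by rw [Finset.card_insert_of_notMem hya, hcard], Finset.subset_insert _ _⟩
      · exact ⟨hR.insert_of_isMax hμR hμ (hy b) (hymax b),
          by rw [Finset.card_insert_of_notMem hyb, hcard], Finset.subset_insert _ _⟩
  rw [key, Finset.card_pair]
  intro h
  have : y a ∈ insert (y b) R := h ▸ Finset.mem_insert_self _ _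
  rcases Finset.mem_insert.1 this with h | h
  exacts [hyab h, hya h]

/-- A set with as many elements as there are colors, but not carrying all of them, has an even
number of subsets of one element fewer that carry exactly the colors other than `k`. -/
theorem card_subsets_image_eq_erase_even [Fintype ι] [DecidableEq ι] (c : V → ι) (k : ι)
    {S : Finset V} (hS : S.card = Fintype.card ι) (hc : S.image c ≠ Finset.univ) :
    Even (S.powerset.filter
      fun R => R.card + 1 = Fintype.card ι ∧ R.image c = Finset.univ.erase k).card := by
  rcases Finset.eq_empty_or_nonempty (S.powerset.filter
      fun R => R.card + 1 = Fintype.card ι ∧ R.image c = Finset.univ.erase k) with h0 | ⟨R, hR⟩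
  · simp [h0]
  simp only [Finset.mem_filter, Finset.mem_powerset] at hR
  obtain ⟨hRS, hRc, hRi⟩ := hR
  obtain ⟨v, hvR, rfl⟩ : ∃ v, v ∉ R ∧ insert v R = S :=
        Finset.exists_eq_insert_iff.2 ⟨hRS, by omega⟩
  have hvk : c v ≠ k := by
    intro h
    apply hc
    rw [Finset.image_insert, hRi, h, Finset.insert_erase (Finset.mem_univ _)]
  have hinj : Set.InjOn c R := by
    apply Finset.card_image_iff.1
    rw [hRi, Finset.card_erase_of_mem (Finset.mem_univ _), Finset.card_univ]; omega
  obtain ⟨w, hwR, hwv⟩ : ∃ w ∈ R, c w = c v := by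
    apply Finset.mem_image.1
    rw [hRi]; simpa using hvk
  have hwv' : w ≠ v := fun h => hvR (h ▸ hwR)
  have key : (insert v R).powerset.filter
      (fun R => R.card + 1 = Fintype.card ι ∧ R.image c = Finset.univ.erase k) =
      {R, (insert v R).erase w} := by
    ext Q
    simp only [Finset.mem_filter, Finset.mem_powerset, Finset.mem_insert, Finset.mem_singleton]
    constructor
    · rintro ⟨hQS, hQc, hQi⟩
      obtain ⟨u, hu⟩ := Finset.card_eq_one.1 (show (insert v R \ Q).card = 1 by
        rw [Finset.card_sdiff_of_subset hQS]; omega)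
      have hQ : Q = (insert v R).erase u := by
        rw [Finset.erase_eq, ← hu, Finset.sdiff_sdiff_eq_self hQS]
      have huS : u ∈ insert v R := (Finset.mem_sdiff.1 (hu ▸ Finset.mem_singleton_self u)).1
      rcases Finset.mem_insert.1 huS with rfl | huR
      · left; rw [hQ, Finset.erase_insert hvR]
      · right
        rw [hQ]
        congr 1
        have huk : c u ∈ Q.image c := by
          rw [hQi, ← hRi]; exact Finset.mem_image_of_mem _ huR
        obtain ⟨q, hq, hqu⟩ := Finset.mem_image.1 huk
        rw [hQ, Finset.mem_erase, Finset.mem_insert] at hq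
        rcases hq with ⟨hqu', rfl | hqR⟩
        · exact hinj huR hwR (by rw [hwv, hqu])
        · exact absurd (hinj hqR huR hqu) hqu'
    · rintro (rfl | rfl)
      · exact ⟨Finset.subset_insert _ _, hRc, hRi⟩
      · refine ⟨Finset.erase_subset _ _, ?_, ?_⟩
        · rw [Finset.card_erase_of_mem (by simp [hwR]), hS]
          have := Fintype.card_pos_iff.2 ⟨k⟩
          omega
        · rw [← hRi]
          ext i
          simp only [Finset.mem_image, Finset.mem_erase, Finset.mem_insert]
          constructor
          · rintro ⟨x, ⟨hxw, rfl | hx⟩, rfl⟩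
            · exact ⟨w, hwR, hwv⟩
            · exact ⟨x, hx, rfl⟩
          · rintro ⟨x, hx, rfl⟩
            by_cases h : x = w
            · exact ⟨v, ⟨hwv'.symm, Or.inl rfl⟩, by rw [h, hwv]⟩
            · exact ⟨x, ⟨h, Or.inr hx⟩, rfl⟩
  rw [key, Finset.card_pair]
  · exact even_two
  · intro h
    have : w ∈ (insert v R).erase w := h ▸ hwR
    simp at this

end Dominant

/-- **Scarf's lemma** for colorings: each index `i` is adjoined as a point that comes first in
the ranking `i` and after all points of `T` in the other rankings. -/
theorem exists_isDominant_image_eq_univ {T ι α : Type*} [LinearOrder α] [Fintype T] [Nonempty T]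
    [DecidableEq T] [Fintype ι] [DecidableEq ι] [Nonempty ι] {f : ι → T ⊕ ι → α}
    (hf : ∀ i, Function.Injective (f i))
    (hlow : ∀ i t, f i (Sum.inr i) < f i (Sum.inl t))
    (hhigh : ∀ i j t, j ≠ i → f i (Sum.inl t) < f i (Sum.inr j)) (c : T → ι) :
    ∃ S : Finset (T ⊕ ι), IsDominant f S ∧ S.card = Fintype.card ι ∧
      S.image (Sum.elim c id) = Finset.univ := by
  classical
  by_contra! hcon
  obtain ⟨k⟩ := ‹Nonempty ι›
  set d : T ⊕ ι → ι := Sum.elim c id with hd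
  have hlow' : ∀ i v, f i (Sum.inr i) ≤ f i v := by
    rintro i (t | j)
    · exact (hlow i t).le
    · by_cases h : j = i
      · rw [h]
      · obtain ⟨t⟩ := ‹Nonempty T›
        exact ((hlow i t).trans (hhigh i j t h)).le
  let rooms : Finset (Finset (T ⊕ ι)) :=
    Finset.univ.filter fun S => IsDominant f S ∧ S.card = Fintype.card ι
  let doors : Finset (Finset (T ⊕ ι)) := Finset.univ.filter fun R => IsDominant f R ∧
    R.card + 1 = Fintype.card ι ∧ R.image d = Finset.univ.erase k
  have hcount := Finset.sum_card_bipartiteAbove_eq_sum_card_bipartiteBelow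
    (s := doors) (t := rooms) (fun R S => R ⊆ S)
  have heven : Even (∑ S ∈ rooms, (Finset.bipartiteBelow (fun R S => R ⊆ S) doors S).card) := by
    refine Finset.even_sum _ fun S hS => ?_
    obtain ⟨hSd, hSc⟩ := (Finset.mem_filter.1 hS).2
    have h := card_subsets_image_eq_erase_even d k hSc (hcon S hSd hSc)
    refine (congrArg (fun s => Even (Finset.card s)) ?_).mpr h
    ext R
    simp only [Finset.bipartiteBelow, doors, Finset.mem_filter, Finset.mem_univ, true_and,
      Finset.mem_powerset]
    exact ⟨fun h => ⟨h.2, h.1.2⟩, fun h => ⟨⟨hSd.mono h.1, h.2⟩, h.1⟩⟩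
  let R₀ : Finset (T ⊕ ι) := (Finset.univ.erase k).image Sum.inr
  have hR₀c : R₀.card + 1 = Fintype.card ι := by
    rw [Finset.card_image_of_injective _ Sum.inr_injective,
      Finset.card_erase_of_mem (Finset.mem_univ _), Finset.card_univ]
    have := Fintype.card_pos_iff.2 ⟨k⟩
    omega
  obtain ⟨t₀, -, ht₀⟩ := Finset.univ.exists_max_image (fun t => f k (Sum.inl t))
    (Finset.univ_nonempty (α := T))
  have hdom₀ : IsDominant f (insert (Sum.inl t₀) R₀) := by
    rintro (t | j)
    · refine ⟨k, fun x hx => ?_⟩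
      simp only [R₀, Finset.mem_insert, Finset.mem_image, Finset.mem_erase, Finset.mem_univ,
        and_true] at hx
      rcases hx with rfl | ⟨j, hj, rfl⟩
      · exact ht₀ t (Finset.mem_univ _)
      · exact (hhigh k j t hj).le
    · exact ⟨j, fun x _ => hlow' j x⟩
  have hR₀d : R₀ ∈ doors := by
    refine Finset.mem_filter.2 ⟨Finset.mem_univ _, hdom₀.mono (Finset.subset_insert _ _), hR₀c, ?_⟩
    simp [R₀, Finset.image_image, hd, Function.comp_def]
  have hone : (Finset.bipartiteAbove (fun R S => R ⊆ S) rooms R₀).card = 1 := by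
    rw [Finset.card_eq_one]
    refine ⟨insert (Sum.inl t₀) R₀, ?_⟩
    ext S
    simp only [Finset.bipartiteAbove, rooms, Finset.mem_filter, Finset.mem_univ, true_and,
      Finset.mem_singleton]
    constructor
    · rintro ⟨⟨hSd, hSc⟩, hRS⟩
      obtain ⟨i, hi⟩ := hSd (Sum.inl t₀)
      have hik : i = k := by
        by_contra h
        exact (hlow i t₀).not_ge (hi _ (hRS (Finset.mem_image_of_mem _ (by simpa using h))))
      subst hik
      obtain ⟨v, hv⟩ := Finset.card_eq_one.1 (show (S \ R₀).card = 1 by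
        rw [Finset.card_sdiff_of_subset hRS]; omega)
      have hvS : v ∈ S := (Finset.mem_sdiff.1 (hv ▸ Finset.mem_singleton_self v)).1
      have hvR : v ∉ R₀ := (Finset.mem_sdiff.1 (hv ▸ Finset.mem_singleton_self v)).2
      have hS : S = insert v R₀ := by
        rw [← Finset.sdiff_union_of_subset hRS, hv, Finset.insert_eq]
      rcases v with t | j
      · have := le_antisymm (hi _ hvS) (ht₀ t (Finset.mem_univ _))
        rw [hS, hf _ this]
      · have hj : j = i := by
          by_contra h
          exact hvR (Finset.mem_image_of_mem _ (by simpa using h))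
        subst hj
        exact absurd (hi _ hvS) (not_le.2 (hlow _ _))
    · rintro rfl
      refine ⟨⟨hdom₀, ?_⟩, Finset.subset_insert _ _⟩
      rw [Finset.card_insert_of_notMem (by simp [R₀]), hR₀c]
  have htwo : ∀ R ∈ doors.erase R₀,
      (Finset.bipartiteAbove (fun R S => R ⊆ S) rooms R).card = 2 := by
    intro R hR
    obtain ⟨hRne, hR⟩ := Finset.mem_erase.1 hR
    obtain ⟨-, hRd, hRc, hRi⟩ := Finset.mem_filter.1 hR
    obtain ⟨t, ht⟩ : ∃ t, Sum.inl t ∈ R := by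
      by_contra! h
      apply hRne
      refine Finset.eq_of_subset_of_card_le (fun v hv => ?_) (by omega)
      rcases v with t | j
      · exact absurd hv (h t)
      · have := Finset.mem_image_of_mem d hv
        rw [hRi] at this
        exact Finset.mem_image_of_mem _ this
    refine hRd.card_extensions hf hRc ⟨_, ht⟩
      (fun e => ⟨Sum.inr e, fun i hi => ⟨_, ht, hhigh i e t hi.symm⟩⟩) _ fun S => ?_
    simp [Finset.bipartiteAbove, rooms, and_assoc]
  rw [← Finset.add_sum_erase _ _ hR₀d, hone, Finset.sum_congr rfl htwo] at hcount
  rw [← hcount, Finset.sum_const, smul_eq_mul] at heven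
  obtain ⟨r, hr⟩ := heven
  omega

/-- Every coloring of the lattice points of a simplex admits a small cell
carrying all the colors of a set `C` of directions. -/
theorem exists_colored_cell {ι : Type*} [Fintype ι] [DecidableEq ι] [Nonempty ι] (N : ℕ)
    (c : (ι → ℕ) → ι) :
    ∃ (C : Finset ι) (μ : ι → ℕ) (z : ι → ι → ℕ),
      (∀ i ∈ C, ∑ j, z i j = N ∧ c (z i) = i) ∧ (∀ i ∈ C, ∀ j ∈ C, μ j ≤ z i j) ∧
      N < ∑ j ∈ C, (μ j + 1) := by
  classical
  let T := ↥(Finset.piAntidiag (Finset.univ : Finset ι) N)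
  have hT : ∀ x : ι → ℕ, ∑ j, x j = N → x ∈ Finset.piAntidiag (Finset.univ : Finset ι) N :=
    fun x hx => by simp [Finset.mem_piAntidiag, hx]
  have hT' : ∀ x : T, ∑ j, x.1 j = N := fun x => (Finset.mem_piAntidiag.1 x.2).1
  obtain ⟨k⟩ := ‹Nonempty ι›
  have : Nonempty T := ⟨⟨Pi.single k N, hT _ (by simp)⟩⟩
  let e : T ⊕ ι → ℕ := fun v => (Fintype.equivFin (T ⊕ ι) v : ℕ)
  have he : Function.Injective e := Fin.val_injective.comp (Equiv.injective _)
  let g : ι → T ⊕ ι → ℤ := fun i => Sum.elim (fun t => (t.1 i : ℤ))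
    (fun j => if j = i then -1 else N + 1)
  let f : ι → T ⊕ ι → ℤ ×ₗ ℕ := fun i v => toLex (g i v, e v)
  have hfg : ∀ i v w, f i v ≤ f i w → g i v ≤ g i w := by
    intro i v w h
    rcases Prod.Lex.toLex_le_toLex.1 h with h | h
    exacts [h.le, h.1.le]
  obtain ⟨S, hSd, hSc, hSi⟩ := exists_isDominant_image_eq_univ (f := f)
    (fun i v w h => he (congrArg (fun p => (ofLex p).2) h))
    (fun i t => Prod.Lex.toLex_lt_toLex.2 (Or.inl (by simp [g]; omega)))
    (fun i j t hij => Prod.Lex.toLex_lt_toLex.2 (Or.inl (by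
      have h1 := Finset.single_le_sum (f := t.1) (fun _ _ => Nat.zero_le _) (Finset.mem_univ i)
      rw [hT' t] at h1
      simp [g, hij]; omega)))
    (fun t => c t.1)
  have hdom : ∀ y : T, ∃ i, Sum.inr i ∉ S ∧ ∀ x : T, Sum.inl x ∈ S → y.1 i ≤ x.1 i := by
    intro y
    obtain ⟨i, hi⟩ := hSd (Sum.inl y)
    refine ⟨i, fun h => ?_, fun x hx => ?_⟩
    · have := hfg _ _ _ (hi _ h)
      simp [g] at this
      omega
    · have := hfg _ _ _ (hi _ hx)
      simpa [g] using this
  have hcol : ∀ i, Sum.inr i ∉ S → ∃ x : T, Sum.inl x ∈ S ∧ c x.1 = i := by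
    intro i hi
    obtain ⟨v, hv, hvi⟩ := Finset.mem_image.1 (hSi ▸ Finset.mem_univ i)
    rcases v with t | j
    · exact ⟨t, hv, hvi⟩
    · have : j = i := hvi
      exact absurd hv (this ▸ hi)
  let C : Finset ι := Finset.univ.filter fun i => Sum.inr i ∉ S
  have hC : ∀ i, i ∈ C ↔ Sum.inr i ∉ S := fun i => by simp [C]
  obtain ⟨i₁, hi₁, -⟩ := hdom (Classical.arbitrary T)
  let σ : Finset T := Finset.univ.filter fun x => Sum.inl x ∈ S
  have hσ : ∀ x, x ∈ σ ↔ Sum.inl x ∈ S := fun i => by simp [σ]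
  have hσne : σ.Nonempty := let ⟨x, hx, _⟩ := hcol i₁ hi₁; ⟨x, (hσ x).2 hx⟩
  choose w hwσ hw using fun i => σ.exists_min_image (fun x => x.1 i) hσne
  have : ∀ i, ∃ x : T, i ∈ C → (Sum.inl x ∈ S ∧ c x.1 = i) := fun i => by
    by_cases h : i ∈ C
    · obtain ⟨x, hx⟩ := hcol i ((hC i).1 h)
      exact ⟨x, fun _ => hx⟩
    · exact ⟨Classical.arbitrary T, fun h' => absurd h' h⟩
  choose z hz using this
  refine ⟨C, fun j => (w j).1 j, fun i => (z i).1, fun i hi => ⟨hT' _, (hz i hi).2⟩,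
    fun i hi j _ => hw j _ ((hσ _).2 (hz i hi).1), ?_⟩
  by_contra! hle
  let y : ι → ℕ := fun j => (if j ∈ C then (w j).1 j + 1 else 0) +
    (if j = i₁ then N - ∑ j ∈ C, ((w j).1 j + 1) else 0)
  have hy : ∑ j, y j = N := by
    simp only [y, Finset.sum_add_distrib, Finset.sum_ite_mem, Finset.univ_inter,
      Finset.sum_ite_eq', Finset.mem_univ, if_true]
    simp only [Finset.sum_add_distrib] at hle ⊢
    omega
  obtain ⟨i, hi, hi'⟩ := hdom ⟨y, hT y hy⟩
  have h1 := hi' (w i) ((hσ _).1 (hwσ i))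
  simp only [y, (hC i).2 hi, if_true] at h1
  omega

/-- If every point of the simplex has a small coordinate in the direction of its color, then
arbitrarily small cells carry all colors. -/
theorem exists_close_points_of_coloring {ι : Type*} [Fintype ι] [DecidableEq ι] [Nonempty ι]
    (col : (ι → ℝ) → ι)
    (hcol : ∀ x ∈ stdSimplex ℝ ι,
      (Fintype.card ι : ℝ) ^ 2 * x (col x) ≤ Fintype.card ι + 1)
    {N : ℕ} (hN : Fintype.card ι ^ 3 ≤ N) :
    ∃ z : ι → ι → ℝ, (∀ i, z i ∈ stdSimplex ℝ ι ∧ col (z i) = i) ∧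
      ∀ i k j, z i j - z k j ≤ Fintype.card ι / N := by
  set m := Fintype.card ι with hm
  have hm0 : 0 < m := Fintype.card_pos
  have hN0 : 0 < N := (pow_pos hm0 3).trans_le hN
  have hNR : (0 : ℝ) < N := by exact_mod_cast hN0
  obtain ⟨C, μ, z, hz, hμ, hlt⟩ :=
    exists_colored_cell N (fun x : ι → ℕ => col fun j => (x j : ℝ) / N)
  have hmem : ∀ i ∈ C, (fun j => (z i j : ℝ) / N) ∈ stdSimplex ℝ ι := by
    intro i hi
    refine ⟨fun j => by positivity, ?_⟩
    rw [← Finset.sum_div, ← Nat.cast_sum, (hz i hi).1, div_self hNR.ne']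
  have hCuniv : C = Finset.univ := by
    by_contra hne
    have hcard : C.card + 1 ≤ m := by
      have := Finset.card_lt_card (Finset.ssubset_univ_iff.2 hne)
      rwa [Finset.card_univ] at this
    have hbound : ∀ i ∈ C, m ^ 2 * (μ i + 1) ≤ (m + 1) * N + m ^ 2 := by
      intro i hi
      have h := hcol _ (hmem i hi)
      rw [(hz i hi).2, ← mul_div_assoc, div_le_iff₀ hNR] at h
      have h' : m ^ 2 * z i i ≤ (m + 1) * N := by exact_mod_cast h
      have := Nat.mul_le_mul_left (m ^ 2) (hμ i hi i hi)
      linarith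
    have h1 : m ^ 2 * ∑ j ∈ C, (μ j + 1) ≤ C.card * ((m + 1) * N + m ^ 2) := by
      rw [Finset.mul_sum, ← smul_eq_mul (a := C.card)]
      exact Finset.sum_le_card_nsmul _ _ _ hbound
    have h2 : m ^ 2 * (N + 1) ≤ m ^ 2 * ∑ j ∈ C, (μ j + 1) := Nat.mul_le_mul_left _ hlt
    obtain ⟨q, hq⟩ : ∃ q, m = q + 1 := ⟨m - 1, by omega⟩
    have h3 : C.card * ((m + 1) * N + m ^ 2) ≤ q * ((m + 1) * N + m ^ 2) :=
      Nat.mul_le_mul_right _ (by omega)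
    have h4 := h2.trans (h1.trans h3)
    rw [hq] at h4 hN
    nlinarith
  subst hCuniv
  refine ⟨fun i j => (z i j : ℝ) / N, fun i => ⟨hmem i (Finset.mem_univ i),
    (hz i (Finset.mem_univ i)).2⟩, fun i k j => ?_⟩
  rw [← sub_div]
  refine div_le_div_of_nonneg_right ?_ hNR.le
  have h1 := (hz i (Finset.mem_univ i)).1
  rw [← Finset.add_sum_erase _ _ (Finset.mem_univ j)] at h1
  rw [Finset.sum_add_distrib, ← Finset.add_sum_erase _ _ (Finset.mem_univ j)] at hlt
  have h2 : ∑ l ∈ Finset.univ.erase j, μ l ≤ ∑ l ∈ Finset.univ.erase j, z i l :=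
    Finset.sum_le_sum fun l _ => hμ i (Finset.mem_univ i) l (Finset.mem_univ l)
  have h3 := hμ k (Finset.mem_univ k) j (Finset.mem_univ j)
  simp only [Finset.sum_const, Finset.card_univ, smul_eq_mul, mul_one] at hlt
  have h4 : z i j ≤ z k j + m := by omega
  have h5 : (z i j : ℝ) ≤ z k j + m := by exact_mod_cast h4
  linarith

open Filter Topology in
/-- If every point of the simplex has a small coordinate in the direction of its color, then
some point is a limit of points of every color. -/
theorem exists_mem_closure_of_coloring {ι : Type*} [Fintype ι] [DecidableEq ι] [Nonempty ι]
    (col : (ι → ℝ) → ι)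
    (hcol : ∀ x ∈ stdSimplex ℝ ι,
      (Fintype.card ι : ℝ) ^ 2 * x (col x) ≤ Fintype.card ι + 1) :
    ∃ x : ι → ℝ, ∀ i, x ∈ closure {y ∈ stdSimplex ℝ ι | col y = i} := by
  choose z hz hclose using fun n : ℕ =>
    exists_close_points_of_coloring col hcol (Nat.le_add_left (Fintype.card ι ^ 3) n)
  obtain ⟨k⟩ := ‹Nonempty ι›
  obtain ⟨x, -, φ, hφ, hx⟩ := (isCompact_stdSimplex ℝ ι).tendsto_subseq fun n => (hz n k).1
  refine ⟨x, fun i => mem_closure_of_tendsto (f := fun n => z (φ n) i) (b := atTop) ?_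
    (Eventually.of_forall fun n => hz (φ n) i)⟩
  have hsmall : Tendsto (fun n : ℕ => (Fintype.card ι : ℝ) / ((n + Fintype.card ι ^ 3 : ℕ) : ℝ))
      atTop (𝓝 0) :=
    (tendsto_const_div_atTop_nhds_zero_nat (Fintype.card ι : ℝ)).comp
      (tendsto_add_atTop_nat (Fintype.card ι ^ 3))
  rw [tendsto_pi_nhds] at hx ⊢
  intro j
  have hdiff : Tendsto (fun n => z (φ n) i j - z (φ n) k j) atTop (𝓝 0) :=
    squeeze_zero_norm (fun n => abs_sub_le_iff.2 ⟨hclose (φ n) i k j, hclose (φ n) k i j⟩)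
      (hsmall.comp hφ.tendsto_atTop)
  simpa using hdiff.add (hx j)

/-- There is a continuous self-map of the simplex whose positive coordinates at `x` are those in
which `x` is not much larger than the barycenter. -/
theorem exists_continuous_reflection (ι : Type*) [Fintype ι] [Nonempty ι] :
    ∃ φ : (ι → ℝ) → ι → ℝ, Continuous φ ∧ ∀ x ∈ stdSimplex ℝ ι, φ x ∈ stdSimplex ℝ ι ∧
      ∀ j, 0 < φ x j → (Fintype.card ι : ℝ) ^ 2 * x j ≤ Fintype.card ι + 1 := by
  set m : ℝ := (Fintype.card ι : ℝ) with hm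
  have hm1 : 1 ≤ m := Nat.one_le_cast.2 (Fintype.card_pos (α := ι))
  let w : (ι → ℝ) → ι → ℝ := fun x j => max 0 (m + 1 - m ^ 2 * x j)
  have hw : ∀ x j, 0 ≤ w x j := fun x j => le_max_left _ _
  refine ⟨fun x j => w x j / max 1 (∑ l, w x l), ?_, fun x hx => ⟨⟨fun j => ?_, ?_⟩, fun j hj => ?_⟩⟩
  · refine continuous_pi fun j => Continuous.div (by fun_prop) (by fun_prop) fun x => ?_
    positivity
  · exact div_nonneg (hw x j) (by positivity)
  · have h1 : ∑ j, (m + 1 - m ^ 2 * x j) ≤ ∑ l, w x l :=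
      Finset.sum_le_sum fun j _ => le_max_right _ _
    rw [Finset.sum_sub_distrib, ← Finset.mul_sum, hx.2, Finset.sum_const, Finset.card_univ,
      nsmul_eq_mul, ← hm] at h1
    have h2 : 1 ≤ ∑ l, w x l := by nlinarith
    rw [← Finset.sum_div, max_eq_right h2, div_self (by linarith)]
  · by_contra! hlt
    have : w x j = 0 := max_eq_left (by linarith)
    simp [this] at hj

theorem mem_convexHull_single_of_mem_stdSimplex {ι : Type*} [Fintype ι] [DecidableEq ι]
    {x : ι → ℝ} (hx : x ∈ stdSimplex ℝ ι) {θ : Finset ι} (hθ : ∀ i, i ∉ θ → x i = 0) :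
    x ∈ convexHull ℝ ((fun i => Pi.single i (1 : ℝ)) '' (θ : Set ι)) := by
  have hsum : ∑ i ∈ θ, x i = 1 := by
    rw [← hx.2]
    exact Finset.sum_subset (Finset.subset_univ _) fun i _ hi => hθ i hi
  have hxe : x = ∑ i ∈ θ, x i • (Pi.single i (1 : ℝ) : ι → ℝ) := by
    rw [Finset.sum_subset (Finset.subset_univ θ) fun i _ hi => by rw [hθ i hi, zero_smul]]
    exact pi_eq_sum_univ' x
  rw [hxe]
  exact (convex_convexHull ℝ _).sum_mem (fun i _ => hx.1 i) hsum fun i hi =>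
    subset_convexHull ℝ _ (Set.mem_image_of_mem _ hi)

/-- **The Knaster–Kuratowski–Mazurkiewicz theorem.** If closed subsets `C₀, …, Cₙ` of the
standard `n`-simplex are such that each face spanned by the vertices `{eᵢ : i ∈ θ}` is
contained in `⋃ i ∈ θ, Cᵢ`, then all the `Cᵢ` have a common point. -/
theorem kkm (n : ℕ) (C : Fin (n + 1) → Set (Fin (n + 1) → ℝ))
    (hclosed : ∀ i, IsClosed (C i))
    (hsub : ∀ i, C i ⊆ stdSimplex ℝ (Fin (n + 1)))
    (hcover : ∀ θ : Finset (Fin (n + 1)), θ.Nonempty →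
      convexHull ℝ ((fun i => Pi.single i (1 : ℝ)) '' ↑θ) ⊆ ⋃ i ∈ θ, C i) :
    (⋂ i, C i).Nonempty := by
  obtain ⟨φ, hφc, hφ⟩ := exists_continuous_reflection (Fin (n + 1))
  have hex : ∀ x, ∃ i, x ∈ stdSimplex ℝ (Fin (n + 1)) → 0 < φ x i ∧ φ x ∈ C i := by
    intro x
    by_cases hx : x ∈ stdSimplex ℝ (Fin (n + 1))
    · have hφx := (hφ x hx).1
      let θ : Finset (Fin (n + 1)) := Finset.univ.filter fun i => 0 < φ x i
      have hmem := mem_convexHull_single_of_mem_stdSimplex hφx (θ := θ) fun i hi =>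
        le_antisymm (not_lt.1 (by simpa [θ] using hi)) (hφx.1 i)
      have hθ : θ.Nonempty := by
        rw [Finset.nonempty_iff_ne_empty]
        intro h
        simp [h] at hmem
      obtain ⟨i, hi, hiC⟩ := Set.mem_iUnion₂.1 (hcover θ hθ hmem)
      exact ⟨i, fun _ => ⟨by simpa [θ] using hi, hiC⟩⟩
    · exact ⟨0, fun h => absurd h hx⟩
  choose col hcol using hex
  obtain ⟨x, hx⟩ := exists_mem_closure_of_coloring col fun x hx =>
    (hφ x hx).2 _ (hcol x hx).1
  refine ⟨φ x, Set.mem_iInter.2 fun i => ?_⟩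
  refine closure_minimal ?_ ((hclosed i).preimage hφc) (hx i)
  rintro y ⟨hy, rfl⟩
  exact (hcol y hy).2
end

section
/- (Brouwer fixed point theorem via KKM) Every continuous map f from the standard n-simplex Δ to itself has a fixed point. -/
/-- A map on a finite set whose image has exactly one element fewer than the set identifies
exactly one pair of points. -/
lemma exists_unique_collision {β γ : Type*} [DecidableEq β] [DecidableEq γ] {s : Finset β}
    {g : β → γ} (h : (s.image g).card + 1 = s.card) :
    ∃ a ∈ s, ∃ b ∈ s, a ≠ b ∧ g a = g b ∧
      ∀ x ∈ s, ∀ y ∈ s, x ≠ y → g x = g y → (x = a ∧ y = b) ∨ (x = b ∧ y = a) := by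
  obtain ⟨a, ha, b, hb, hab, hg⟩ := Finset.exists_ne_map_eq_of_card_lt_of_maps_to
    (s := s) (t := s.image g) (f := g) (by omega) (fun x hx => Finset.mem_image_of_mem g hx)
  have inj : ∀ a ∈ s, ∀ b ∈ s, a ≠ b → g a = g b → Set.InjOn g (s.erase a) := by
    intro a ha b hb hab hg
    apply Finset.injOn_of_card_image_eq
    have : (s.erase a).image g = s.image g := by
      apply Finset.Subset.antisymm (Finset.image_subset_image (Finset.erase_subset _ _))
      intro z hz
      obtain ⟨x, hx, rfl⟩ := Finset.mem_image.1 hz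
      by_cases hxa : x = a
      · subst hxa
        exact Finset.mem_image.2 ⟨b, Finset.mem_erase.2 ⟨hab.symm, hb⟩, hg.symm⟩
      · exact Finset.mem_image_of_mem g (Finset.mem_erase.2 ⟨hxa, hx⟩)
    rw [this, Finset.card_erase_of_mem ha]
    omega
  have h₁ := inj a ha b hb hab hg
  have h₂ := inj b hb a ha hab.symm hg.symm
  refine ⟨a, ha, b, hb, hab, hg, fun x hx y hy hxy hgxy => ?_⟩
  have k₁ : x = a ∨ y = a := by
    by_contra! hne
    exact hxy (h₁ (by simp [hne.1, hx]) (by simp [hne.2, hy]) hgxy)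
  have k₂ : x = b ∨ y = b := by
    by_contra! hne
    exact hxy (h₂ (by simp [hne.1, hx]) (by simp [hne.2, hy]) hgxy)
  grind

section Scarf

variable {V I α : Type*} [LinearOrder α]

/-- A finite set `R` is dominating for the family of orders induced by `u i` if no point
exceeds the minimum of `R` in all the orders at once. -/
def IsDominating (u : I → V → α) (R : Finset V) : Prop :=
  ∀ y, ∃ i, ∀ x ∈ R, u i y ≤ u i x

lemma IsDominating.mono {u : I → V → α} {R S : Finset V} (h : IsDominating u S) (hRS : R ⊆ S) :
    IsDominating u R := fun y => (h y).imp fun _ hi x hx => hi x (hRS hx)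

/-- Every element of a dominating set is its minimum in one of the orders. -/
lemma IsDominating.image_eq [Fintype I] [DecidableEq V] {u : I → V → α}
    (hu : ∀ i, Function.Injective (u i)) {R : Finset V} (h : IsDominating u R) {μ : I → V}
    (hμ : ∀ i, μ i ∈ R) (hmin : ∀ i, ∀ x ∈ R, u i (μ i) ≤ u i x) :
    Finset.univ.image μ = R := by
  apply Finset.Subset.antisymm
  · intro x hx
    obtain ⟨i, -, rfl⟩ := Finset.mem_image.1 hx
    exact hμ i
  · intro x hx
    obtain ⟨i, hi⟩ := h x
    exact Finset.mem_image.2 ⟨i, Finset.mem_univ _, hu i (le_antisymm (hmin i x hx) (hi _ (hμ i)))⟩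

/-- A nonempty set with one element fewer than there are orders, which is not cut out by the
slack points, extends in an even number of ways to a dominating set. -/
lemma even_card_dominating_extensions [Fintype V] [Fintype I] [DecidableEq V] {u : I → V → α}
    (hu : ∀ i, Function.Injective (u i)) {e : I → V} (hinj : Function.Injective e)
    (he : ∀ i y, u i (e i) ≤ u i y)
    (he' : ∀ i k, i ≠ k → ∀ y ∉ Set.range e, u i y < u i (e k))
    {D : Finset V} (hD : D.card + 1 = Fintype.card I) {t : V} (ht : t ∈ D)
    (hte : t ∉ Set.range e) [DecidablePred fun y => y ∉ D ∧ IsDominating u (insert y D)] :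
    Even (Finset.univ.filter fun y => y ∉ D ∧ IsDominating u (insert y D)).card := by
  classical
  by_cases hdom : IsDominating u D
  swap
  · rw [Finset.filter_false_of_mem]
    · simp
    · rintro y - ⟨-, hy⟩
      exact hdom (hy.mono (Finset.subset_insert _ _))
  have hex : ∀ i, ∃ z ∈ D, ∀ x ∈ D, u i z ≤ u i x := fun i =>
    Finset.exists_min_image D (u i) ⟨t, ht⟩
  choose μ hμ hmin using hex
  have himg := hdom.image_eq hu hμ hmin
  obtain ⟨i, -, j, -, hij, hμij, huniq⟩ := exists_unique_collision
    (s := (Finset.univ : Finset I)) (g := μ) (by rw [himg, hD, Finset.card_univ])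
  have hcase : ∀ a, μ a = e a ∨ μ a ∉ Set.range e := by
    intro a
    by_cases ha : μ a ∈ Set.range e
    · obtain ⟨b, hb⟩ := ha
      by_cases hab : a = b
      · left; rw [← hb, hab]
      · have h₁ := he' a b hab t hte
        have h₂ := hmin a t ht
        rw [← hb] at h₂
        exact absurd h₁ (not_lt.2 h₂)
    · exact Or.inr ha
  have hnot : μ i ∉ Set.range e := by
    rcases hcase i with h | h
    · rcases hcase j with h' | h'
      · exact absurd (hinj (h.symm.trans (hμij.trans h'))) hij
      · rwa [hμij]
    · exact h
  -- the points exceeding the minimum of `D` in every order except possibly the one of `k`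
  let A : I → Finset V := fun k => Finset.univ.filter fun y => ∀ h, h ≠ k → u h (μ h) < u h y
  have memA : ∀ k y, y ∈ A k ↔ ∀ h, h ≠ k → u h (μ h) < u h y := by simp [A]
  have hne : ∀ k, μ k ∉ Set.range e → (A k).Nonempty := by
    intro k hk
    refine ⟨e k, (memA _ _).2 fun h hhk => ?_⟩
    rcases hcase h with h' | h'
    · rw [h']
      exact lt_of_le_of_ne (he _ _) fun hc => hhk (hinj (hu h hc))
    · exact he' h k hhk _ h'
  have key : ∀ k l, k ≠ l → μ k = μ l → ∀ y ∈ A k, (∀ w ∈ A k, u k w ≤ u k y) →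
      y ∉ D ∧ IsDominating u (insert y D) := by
    intro k l hkl hμkl y hy hmax
    have hy' := (memA _ _).1 hy
    have hyk : ∀ x ∈ D, u k y ≤ u k x := by
      obtain ⟨h, hh⟩ := hdom y
      by_cases hhk : h = k
      · rwa [← hhk]
      · exact absurd (hh _ (hμ h)) (not_le.2 (hy' h hhk))
    refine ⟨fun hyD => ?_, fun w => ?_⟩
    · have h₁ : y = μ k := hu k (le_antisymm (hyk _ (hμ k)) (hmin k y hyD))
      have h₂ := hy' l hkl.symm
      rw [h₁, hμkl] at h₂
      exact lt_irrefl _ h₂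
    · by_cases hw : w ∈ A k
      · refine ⟨k, fun x hx => ?_⟩
        rcases Finset.mem_insert.1 hx with rfl | hx
        · exact hmax w hw
        · exact (hmax w hw).trans (hyk x hx)
      · rw [memA] at hw
        push Not at hw
        obtain ⟨h, hhk, hw⟩ := hw
        refine ⟨h, fun x hx => ?_⟩
        rcases Finset.mem_insert.1 hx with rfl | hx
        · exact hw.trans (hy' h hhk).le
        · exact hw.trans (hmin h x hx)
  obtain ⟨a, haA, hamax⟩ := Finset.exists_max_image (A i) (u i) (hne i hnot)
  obtain ⟨b, hbA, hbmax⟩ := Finset.exists_max_image (A j) (u j) (hne j (hμij ▸ hnot))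
  have hab : a ≠ b := by
    rintro rfl
    obtain ⟨h, hh⟩ := hdom a
    have := hh _ (hμ h)
    by_cases hhi : h = i
    · exact absurd this (not_le.2 ((memA _ _).1 hbA h (hhi ▸ hij)))
    · exact absurd this (not_le.2 ((memA _ _).1 haA h hhi))
  have hS : (Finset.univ.filter fun y => y ∉ D ∧ IsDominating u (insert y D)) = {a, b} := by
    ext y
    simp only [Finset.mem_filter, Finset.mem_univ, true_and, Finset.mem_insert,
      Finset.mem_singleton]
    constructor
    · rintro ⟨hyD, hy⟩
      have hex : ∀ i, ∃ z ∈ insert y D, ∀ x ∈ insert y D, u i z ≤ u i x := fun i =>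
        Finset.exists_min_image _ (u i) ⟨y, Finset.mem_insert_self _ _⟩
      choose ν hν hνmin using hex
      have hνimg := hy.image_eq hu hν hνmin
      have hνinj : Function.Injective ν := by
        rw [← Set.injOn_univ, ← Finset.coe_univ]
        apply Finset.injOn_of_card_image_eq
        rw [hνimg, Finset.card_insert_of_notMem hyD, hD, Finset.card_univ]
      obtain ⟨k, -, hk⟩ := Finset.mem_image.1 (hνimg.symm ▸ Finset.mem_insert_self y D)
      have hνμ : ∀ h, h ≠ k → ν h = μ h := by
        intro h hhk
        have h₁ : ν h ∈ D := by
          rcases Finset.mem_insert.1 (hν h) with h' | h'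
          · exact absurd (hνinj (h'.trans hk.symm)) hhk
          · exact h'
        exact hu h (le_antisymm (hνmin h _ (Finset.mem_insert_of_mem (hμ h))) (hmin h _ h₁))
      have hyA : y ∈ A k := by
        refine (memA _ _).2 fun h hhk => lt_of_le_of_ne ?_ fun hc => ?_
        · rw [← hνμ h hhk]
          exact hνmin h y (Finset.mem_insert_self _ _)
        · exact hyD (hu h hc ▸ hμ h)
      have hymax : ∀ w ∈ A k, u k w ≤ u k y := by
        intro w hw
        obtain ⟨h, hh⟩ := hy w
        by_cases hhk : h = k
        · subst hhk
          exact hh y (Finset.mem_insert_self _ _)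
        · exact absurd (hh _ (Finset.mem_insert_of_mem (hμ h)))
            (not_le.2 ((memA _ _).1 hw h hhk))
      by_cases hki : k = i
      · subst hki
        exact Or.inl (hu k (le_antisymm (hamax y hyA) (hymax a haA)))
      by_cases hkj : k = j
      · subst hkj
        exact Or.inr (hu k (le_antisymm (hbmax y hyA) (hymax b hbA)))
      · refine absurd (hνinj ?_) hij
        rw [hνμ i (Ne.symm hki), hνμ j (Ne.symm hkj), hμij]
    · rintro (rfl | rfl)
      · exact key i j hij hμij _ haA hamax
      · exact key j i hij.symm hμij.symm _ hbA hbmax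
  rw [hS, Finset.card_pair hab]
  exact even_two

/-- All slack points but one extend in exactly one way to a dominating set. -/
lemma card_dominating_extensions_slack [Fintype V] [Fintype I] [DecidableEq V] [DecidableEq I]
    {u : I → V → α} (hu : ∀ i, Function.Injective (u i)) {e : I → V}
    (hinj : Function.Injective e) (he : ∀ i y, u i (e i) ≤ u i y)
    (he' : ∀ i k, i ≠ k → ∀ y ∉ Set.range e, u i y < u i (e k)) (i₀ : I)
    {D : Finset V} (hD : D = (Finset.univ.erase i₀).image e)
    [DecidablePred fun y => y ∉ D ∧ IsDominating u (insert y D)] :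
    (Finset.univ.filter fun y => y ∉ D ∧ IsDominating u (insert y D)).card = 1 := by
  have memD : ∀ y, y ∈ D ↔ ∃ k, k ≠ i₀ ∧ e k = y := by simp [hD]
  have hi₀ : e i₀ ∉ D := fun h => by
    obtain ⟨k, hk, hk'⟩ := (memD _).1 h
    exact hk (hinj hk')
  obtain ⟨a, ha, hmax⟩ := Finset.exists_max_image Dᶜ (u i₀) ⟨e i₀, Finset.mem_compl.2 hi₀⟩
  rw [Finset.mem_compl] at ha
  rw [Finset.card_eq_one]
  refine ⟨a, ?_⟩
  ext y
  simp only [Finset.mem_filter, Finset.mem_univ, true_and, Finset.mem_singleton]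
  constructor
  · rintro ⟨hyD, hy⟩
    refine hu i₀ (le_antisymm (hmax y (Finset.mem_compl.2 hyD)) ?_)
    obtain ⟨h, hh⟩ := hy a
    by_cases hhi : h = i₀
    · subst hhi
      exact hh y (Finset.mem_insert_self _ _)
    · have hmem : e h ∈ D := (memD _).2 ⟨h, hhi, rfl⟩
      have := hu h (le_antisymm (hh _ (Finset.mem_insert_of_mem hmem)) (he h a))
      exact absurd (this ▸ hmem) ha
  · rintro rfl
    refine ⟨ha, fun w => ?_⟩
    by_cases hw : w ∈ D
    · obtain ⟨k, -, rfl⟩ := (memD _).1 hw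
      exact ⟨k, fun x _ => he k x⟩
    · refine ⟨i₀, fun x hx => ?_⟩
      rcases Finset.mem_insert.1 hx with rfl | hx
      · exact hmax w (Finset.mem_compl.2 hw)
      · obtain ⟨k, hk, rfl⟩ := (memD _).1 hx
        by_cases hwe : w ∈ Set.range e
        · obtain ⟨l, rfl⟩ := hwe
          have : l = i₀ := by
            by_contra hl
            exact hw ((memD _).2 ⟨l, hl, rfl⟩)
          subst this
          exact he _ _
        · exact (he' _ _ hk.symm _ hwe).le

/-- A set with as many points as there are colours, but not carrying all of them, has an even
number of facets carrying exactly the colours other than `i₀`. -/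
lemma even_card_coloured_facets [Fintype V] [Fintype I] [DecidableEq V] [DecidableEq I]
    (c : V → I) (i₀ : I) {R : Finset V} (hR : R.card = Fintype.card I)
    (hc : R.image c ≠ Finset.univ) :
    Even (Finset.univ.filter fun D : Finset V =>
      (D.card + 1 = Fintype.card I ∧ D.image c = Finset.univ.erase i₀) ∧ D ⊆ R).card := by
  classical
  by_cases hne : ∃ D : Finset V, (D.card + 1 = Fintype.card I ∧
      D.image c = Finset.univ.erase i₀) ∧ D ⊆ R
  swap
  · rw [Finset.filter_false_of_mem]
    · simp
    · exact fun D _ hD => hne ⟨D, hD⟩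
  obtain ⟨D₀, ⟨-, hD₀⟩, hD₀R⟩ := hne
  have hsub : Finset.univ.erase i₀ ⊆ R.image c := hD₀ ▸ Finset.image_subset_image hD₀R
  have hRc : R.image c = Finset.univ.erase i₀ := by
    refine Finset.Subset.antisymm (fun z hz => ?_) hsub
    refine Finset.mem_erase.2 ⟨?_, Finset.mem_univ _⟩
    rintro rfl
    refine hc (Finset.eq_univ_iff_forall.2 fun k => ?_)
    by_cases hk : k = z
    · rwa [hk]
    · exact hsub (Finset.mem_erase.2 ⟨hk, Finset.mem_univ _⟩)
  have hpos : 0 < Fintype.card I := Fintype.card_pos_iff.2 ⟨i₀⟩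
  have hcard : (R.image c).card + 1 = R.card := by
    rw [hRc, Finset.card_erase_of_mem (Finset.mem_univ _), Finset.card_univ, hR]
    omega
  obtain ⟨a, ha, b, hb, hab, hcab, huniq⟩ := exists_unique_collision hcard
  have hfacet : ∀ a ∈ R, ∀ b ∈ R, a ≠ b → c a = c b →
      ((R.erase a).card + 1 = Fintype.card I ∧
        (R.erase a).image c = Finset.univ.erase i₀) ∧ R.erase a ⊆ R := by
    intro a ha b hb hab hcab
    refine ⟨⟨by rw [Finset.card_erase_of_mem ha]; omega, ?_⟩, Finset.erase_subset _ _⟩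
    rw [← hRc]
    refine Finset.Subset.antisymm (Finset.image_subset_image (Finset.erase_subset _ _)) ?_
    intro z hz
    obtain ⟨x, hx, rfl⟩ := Finset.mem_image.1 hz
    by_cases hxa : x = a
    · subst hxa
      exact Finset.mem_image.2 ⟨b, Finset.mem_erase.2 ⟨hab.symm, hb⟩, hcab.symm⟩
    · exact Finset.mem_image_of_mem c (Finset.mem_erase.2 ⟨hxa, hx⟩)
  have hS : (Finset.univ.filter fun D : Finset V =>
      (D.card + 1 = Fintype.card I ∧ D.image c = Finset.univ.erase i₀) ∧ D ⊆ R) =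
      {R.erase a, R.erase b} := by
    ext D
    simp only [Finset.mem_filter, Finset.mem_univ, true_and, Finset.mem_insert,
      Finset.mem_singleton]
    constructor
    · rintro ⟨⟨hDcard, hDc⟩, hDR⟩
      obtain ⟨x, hxR, hxD⟩ : ∃ x ∈ R, x ∉ D := by
        by_contra! h
        have := Finset.card_le_card (show R ⊆ D from h)
        omega
      have hDx : D = R.erase x := by
        apply Finset.eq_of_subset_of_card_le (Finset.subset_erase.2 ⟨hDR, hxD⟩)
        rw [Finset.card_erase_of_mem hxR]
        omega
      have hcx : c x ∈ D.image c := by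
        rw [hDc, ← hRc]
        exact Finset.mem_image_of_mem c hxR
      obtain ⟨y, hyD, hy⟩ := Finset.mem_image.1 hcx
      rcases huniq x hxR y (hDR hyD) (fun h => hxD (h ▸ hyD)) hy.symm with h | h
      · exact Or.inl (h.1 ▸ hDx)
      · exact Or.inr (h.1 ▸ hDx)
    · rintro (rfl | rfl)
      · exact hfacet a ha b hb hab hcab
      · exact hfacet b hb a ha hab.symm hcab.symm
  have hne : R.erase a ≠ R.erase b := fun h =>
    Finset.notMem_erase a R (h ▸ Finset.mem_erase.2 ⟨hab, ha⟩)
  rw [hS, Finset.card_pair hne]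
  exact even_two

/-- **Scarf's lemma**: for a finite set with a family of linear orders and a slack point for
each order, every colouring by the orders admits a dominating set carrying all colours. -/
theorem exists_dominating_rainbow [Fintype V] [Fintype I] [Nonempty I] {u : I → V → α}
    (hu : ∀ i, Function.Injective (u i)) {e : I → V}
    (he : ∀ i y, u i (e i) ≤ u i y)
    (he' : ∀ i k, i ≠ k → ∀ y ∉ Set.range e, u i y < u i (e k))
    {c : V → I} (hc : ∀ i, c (e i) = i) :
    ∃ R : Finset V, IsDominating u R ∧ ∀ i, ∃ x ∈ R, c x = i := by
  classical
  by_contra! hcon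
  have hinj : Function.Injective e := fun a b h => by rw [← hc a, ← hc b, h]
  obtain ⟨i₀⟩ := ‹Nonempty I›
  have hpos : 0 < Fintype.card I := Fintype.card_pos_iff.2 ⟨i₀⟩
  let rooms : Finset (Finset V) :=
    Finset.univ.filter fun R => R.card = Fintype.card I ∧ IsDominating u R
  let doors : Finset (Finset V) :=
    Finset.univ.filter fun D => D.card + 1 = Fintype.card I ∧ D.image c = Finset.univ.erase i₀
  let D₀ : Finset V := (Finset.univ.erase i₀).image e
  have hD₀ : D₀ ∈ doors := by
    refine Finset.mem_filter.2 ⟨Finset.mem_univ _, ?_, ?_⟩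
    · rw [Finset.card_image_of_injective _ hinj, Finset.card_erase_of_mem (Finset.mem_univ _),
        Finset.card_univ]
      omega
    · rw [Finset.image_image, show c ∘ e = id from funext hc, Finset.image_id]
  have hext : ∀ D ∈ doors, (rooms.filter fun R => D ⊆ R).card =
      (Finset.univ.filter fun y => y ∉ D ∧ IsDominating u (insert y D)).card := by
    intro D hD
    have hDcard := (Finset.mem_filter.1 hD).2.1
    symm
    refine Finset.card_bij (fun y _ => insert y D) ?_ ?_ ?_
    · intro y hy
      obtain ⟨-, hyD, hy⟩ := Finset.mem_filter.1 hy
      refine Finset.mem_filter.2 ⟨Finset.mem_filter.2 ⟨Finset.mem_univ _, ?_, hy⟩,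
        Finset.subset_insert _ _⟩
      rw [Finset.card_insert_of_notMem hyD, hDcard]
    · intro y hy z _ hyz
      have hyD := (Finset.mem_filter.1 hy).2.1
      have : y ∈ insert z D := hyz ▸ Finset.mem_insert_self y D
      exact (Finset.mem_insert.1 this).resolve_right hyD
    · intro R hR
      obtain ⟨hR, hDR⟩ := Finset.mem_filter.1 hR
      obtain ⟨-, hRcard, hRdom⟩ := Finset.mem_filter.1 hR
      obtain ⟨x, hxR, hxD⟩ : ∃ x ∈ R, x ∉ D := by
        by_contra! h
        have := Finset.card_le_card (show R ⊆ D from h)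
        omega
      have hRx : insert x D = R := by
        apply Finset.eq_of_subset_of_card_le (Finset.insert_subset hxR hDR)
        rw [Finset.card_insert_of_notMem hxD]
        omega
      exact ⟨x, Finset.mem_filter.2 ⟨Finset.mem_univ _, hxD, hRx.symm ▸ hRdom⟩, hRx⟩
  have hcount : ∑ D ∈ doors, (rooms.filter fun R => D ⊆ R).card =
      ∑ R ∈ rooms, (doors.filter fun D => D ⊆ R).card :=
    Finset.sum_card_bipartiteAbove_eq_sum_card_bipartiteBelow _
  have heven : Even (∑ R ∈ rooms, (doors.filter fun D => D ⊆ R).card) := by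
    refine Finset.even_sum _ fun R hR => ?_
    obtain ⟨-, hRcard, hRdom⟩ := Finset.mem_filter.1 hR
    rw [Finset.filter_filter]
    refine even_card_coloured_facets c i₀ hRcard fun h => ?_
    obtain ⟨i, hi⟩ := hcon R hRdom
    obtain ⟨x, hx, hxi⟩ := Finset.mem_image.1 (h.symm ▸ Finset.mem_univ i)
    exact hi x hx hxi
  rw [← hcount, ← Finset.add_sum_erase _ _ hD₀, hext D₀ hD₀,
    card_dominating_extensions_slack hu hinj he he' i₀ rfl] at heven
  have hrest : Even (∑ D ∈ doors.erase D₀, (rooms.filter fun R => D ⊆ R).card) := by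
    refine Finset.even_sum _ fun D hD => ?_
    obtain ⟨hne, hD⟩ := Finset.mem_erase.1 hD
    rw [hext D hD]
    obtain ⟨-, hDcard, hDc⟩ := Finset.mem_filter.1 hD
    obtain ⟨t, ht, hte⟩ : ∃ t ∈ D, t ∉ Set.range e := by
      by_contra! h
      refine hne (Finset.eq_of_subset_of_card_le (fun x hx => ?_) ?_)
      · obtain ⟨k, rfl⟩ := h x hx
        have : c (e k) ∈ D.image c := Finset.mem_image_of_mem c hx
        rw [hDc, hc] at this
        exact Finset.mem_image_of_mem e this
      · have := (Finset.mem_filter.1 hD₀).2.1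
        omega
    exact even_card_dominating_extensions hu hinj he he' hDcard ht hte
  rw [add_comm, Nat.even_add_one] at heven
  exact heven hrest

end Scarf

/-- Every colouring of the integer points of a dilated simplex by the coordinates has a point
such that, for every colour, either the corresponding coordinate is at most `n` or some point
within distance `n` carries this colour. -/
lemma exists_nearly_rainbow_grid_point (n : ℕ) {l : ℤ} (hl : 0 < l)
    (c : (Fin (n + 1) → ℤ) → Fin (n + 1)) :
    ∃ x : Fin (n + 1) → ℤ, (∀ i, 0 ≤ x i) ∧ ∑ i, x i = l ∧ ∀ i, x i ≤ n ∨
      ∃ y : Fin (n + 1) → ℤ, (∀ i, 0 ≤ y i) ∧ ∑ i, y i = l ∧ c y = i ∧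
        ∀ j, |x j - y j| ≤ n := by
  classical
  let T := {v : Fin (n + 1) → ℤ // (∀ i, 0 ≤ v i) ∧ ∑ i, v i = l}
  have hTle : ∀ (t : T) i, t.1 i ≤ l := fun t i =>
    (Finset.single_le_sum (fun j _ => t.2.1 j) (Finset.mem_univ i)).trans t.2.2.le
  have : Finite T := by
    refine Set.Finite.subset (Set.finite_Icc (0 : Fin (n + 1) → ℤ) fun _ => l) ?_
    intro v hv
    exact ⟨hv.1, hTle ⟨v, hv⟩⟩
  have := Fintype.ofFinite T
  let V := T ⊕ Fin (n + 1)
  let p : V → Fin (n + 1) → ℤ :=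
    Sum.elim Subtype.val fun k j => if j = k then -1 else l + 1
  let u : Fin (n + 1) → V → ℤ ×ₗ Fin (Fintype.card V) := fun i x =>
    toLex (p x i, Fintype.equivFin V x)
  have hlt : ∀ {i x y}, p x i < p y i → u i x < u i y := fun h =>
    Prod.Lex.toLex_lt_toLex.2 (Or.inl h)
  have hle : ∀ {i x y}, u i x ≤ u i y → p x i ≤ p y i := fun {i x y} h => by
    by_contra! hc
    exact absurd h (not_le.2 (hlt hc))
  have hu : ∀ i, Function.Injective (u i) := fun i x y h =>
    (Fintype.equivFin V).injective (congrArg (fun z => (ofLex z).2) h)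
  have pe : ∀ k, p (Sum.inr k) k = -1 := fun k => by simp [p]
  have pe' : ∀ k i, i ≠ k → p (Sum.inr k) i = l + 1 := fun k i h => by simp [p, h]
  have hp : ∀ x i, -1 ≤ p x i := by
    rintro (t | k) i
    · have := t.2.1 i
      change -1 ≤ t.1 i
      omega
    · by_cases h : i = k
      · rw [h, pe]
      · rw [pe' k i h]; omega
  obtain ⟨R, hdom, hR⟩ := exists_dominating_rainbow hu (e := fun k => (Sum.inr k : V))
    (c := Sum.elim (fun t => c t.1) id)
    (by
      rintro i (t | k)
      · apply le_of_lt (hlt _)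
        have := t.2.1 i
        rw [pe]
        change -1 < t.1 i
        omega
      · by_cases h : i = k
        · rw [h]
        · apply le_of_lt (hlt _)
          rw [pe, pe' k i h]
          omega)
    (by
      rintro i k hik (t | j) hy
      · apply hlt
        rw [pe' k i hik]
        have := hTle t i
        change t.1 i < l + 1
        omega
      · exact absurd ⟨j, rfl⟩ hy)
    (fun _ => rfl)
  have hex : ∀ i, ∃ z ∈ R, ∀ x ∈ R, p z i ≤ p x i := fun i =>
    Finset.exists_min_image R (fun x => p x i) ((hR 0).imp fun _ h => h.1)
  choose μ hμ hmin using hex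
  have hsum : l < ∑ i, (p (μ i) i + 1) := by
    by_contra! hc
    let v : Fin (n + 1) → ℤ := fun i =>
      p (μ i) i + 1 + if i = 0 then l - ∑ i, (p (μ i) i + 1) else 0
    have hv : ∀ i, p (μ i) i + 1 ≤ v i := fun i => by
      dsimp only [v]
      split_ifs <;> omega
    have hvT : (∀ i, 0 ≤ v i) ∧ ∑ i, v i = l := by
      refine ⟨fun i => ?_, ?_⟩
      · have := hv i
        have := hp (μ i) i
        omega
      · simp only [v]
        rw [Finset.sum_add_distrib, Finset.sum_ite_eq' Finset.univ (0 : Fin (n + 1))]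
        simp
    obtain ⟨i, hi⟩ := hdom (Sum.inl ⟨v, hvT⟩)
    have h₁ := hle (hi _ (hμ i))
    have h₂ := hv i
    change v i ≤ _ at h₁
    omega
  have hnear : ∀ t : T, Sum.inl t ∈ R → ∀ i, p (μ i) i ≤ t.1 i ∧ t.1 i ≤ p (μ i) i + n := by
    intro t ht i
    have h : ∀ j, p (μ j) j ≤ t.1 j := fun j => hmin j _ ht
    have h₁ : t.1 i - p (μ i) i ≤ ∑ j, (t.1 j - p (μ j) j) :=
      Finset.single_le_sum (f := fun j => t.1 j - p (μ j) j)
        (fun j _ => sub_nonneg.2 (h j)) (Finset.mem_univ i)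
    rw [Finset.sum_sub_distrib, t.2.2] at h₁
    rw [Finset.sum_add_distrib] at hsum
    simp only [Finset.sum_const, Finset.card_univ, Fintype.card_fin, nsmul_eq_mul, mul_one]
      at hsum
    push_cast at hsum
    exact ⟨h i, by omega⟩
  obtain ⟨x, hx⟩ : ∃ x : T, Sum.inl x ∈ R := by
    by_contra! hc
    have : ∑ i, (p (μ i) i + 1) ≤ 0 := by
      refine Finset.sum_nonpos fun i _ => ?_
      obtain ⟨t | k, hz, hzi⟩ := hR i
      · exact absurd hz (hc t)
      · have hki : k = i := hzi
        have := hmin i _ hz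
        rw [hki, pe] at this
        omega
    omega
  refine ⟨x.1, x.2.1, x.2.2, fun i => ?_⟩
  obtain ⟨t | k, hz, hzi⟩ := hR i
  · refine Or.inr ⟨t.1, t.2.1, t.2.2, hzi, fun j => ?_⟩
    have h₁ := hnear x hx j
    have h₂ := hnear t hz j
    rw [abs_le]
    omega
  · have hki : k = i := hzi
    have h₁ := hmin i _ hz
    have h₂ := hnear x hx i
    rw [hki, pe] at h₁
    left
    omega

/-- A continuous self-map of the simplex has points at which no coordinate decreases by more
than `ε`. -/
lemma exists_coord_sub_le {n : ℕ} {f : (Fin (n + 1) → ℝ) → (Fin (n + 1) → ℝ)}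
    (hf : ContinuousOn f (stdSimplex ℝ (Fin (n + 1))))
    (hmaps : Set.MapsTo f (stdSimplex ℝ (Fin (n + 1))) (stdSimplex ℝ (Fin (n + 1))))
    {ε : ℝ} (hε : 0 < ε) :
    ∃ x ∈ stdSimplex ℝ (Fin (n + 1)), ∀ i, x i - f x i ≤ ε := by
  have huc := (isCompact_stdSimplex ℝ (Fin (n + 1))).uniformContinuousOn_of_continuous hf
  obtain ⟨δ, hδ, hδf⟩ := Metric.uniformContinuousOn_iff.1 huc (ε / 2) (half_pos hε)
  have hm : 0 < min δ (ε / 2) := lt_min hδ (half_pos hε)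
  obtain ⟨N, hN⟩ := exists_nat_gt (n / min δ (ε / 2))
  have hN₀ : (0 : ℝ) < N := lt_of_le_of_lt (by positivity) hN
  have hNm : n / (N : ℝ) < min δ (ε / 2) := by
    rw [div_lt_iff₀ hm] at hN
    rw [div_lt_iff₀ hN₀]
    linarith
  let s : (Fin (n + 1) → ℤ) → Fin (n + 1) → ℝ := fun v i => v i / N
  have hs : ∀ v : Fin (n + 1) → ℤ, (∀ i, 0 ≤ v i) → ∑ i, v i = (N : ℤ) →
      s v ∈ stdSimplex ℝ (Fin (n + 1)) := by
    intro v hv hsum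
    refine ⟨fun i => div_nonneg (Int.cast_nonneg (hv i)) hN₀.le, ?_⟩
    rw [← Finset.sum_div, ← Int.cast_sum, hsum, Int.cast_natCast, div_self hN₀.ne']
  have hcol : ∀ x ∈ stdSimplex ℝ (Fin (n + 1)), ∃ i, x i ≤ f x i := by
    intro x hx
    obtain ⟨i, -, hi⟩ := Finset.exists_le_of_sum_le (s := Finset.univ) (f := x) (g := f x)
      Finset.univ_nonempty (by rw [hx.2, (hmaps hx).2])
    exact ⟨i, hi⟩
  have hcol' : ∀ v : Fin (n + 1) → ℤ, ∃ i,
      s v ∈ stdSimplex ℝ (Fin (n + 1)) → s v i ≤ f (s v) i := by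
    intro v
    by_cases h : s v ∈ stdSimplex ℝ (Fin (n + 1))
    · exact (hcol _ h).imp fun _ hi _ => hi
    · exact ⟨0, fun h' => absurd h' h⟩
  choose c hc using hcol'
  obtain ⟨x, hx₀, hxs, hx⟩ := exists_nearly_rainbow_grid_point n (l := N)
    (by exact_mod_cast hN₀) c
  have hxS := hs x hx₀ hxs
  refine ⟨s x, hxS, fun i => ?_⟩
  rcases hx i with h | ⟨y, hy₀, hys, rfl, hxy⟩
  · have h₁ : s x i ≤ n / N := div_le_div_of_nonneg_right (by exact_mod_cast h) hN₀.le
    have h₂ := (hmaps hxS).1 i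
    have := min_le_right δ (ε / 2)
    linarith
  · have hyS := hs y hy₀ hys
    have hcoord : ∀ j, |s x j - s y j| ≤ n / N := fun j => by
      dsimp only [s]
      rw [← sub_div, abs_div, abs_of_pos hN₀]
      exact div_le_div_of_nonneg_right (by exact_mod_cast hxy j) hN₀.le
    have hd : dist (s x) (s y) < δ := by
      refine lt_of_le_of_lt ((dist_pi_le_iff (by positivity)).2 fun j => ?_)
        (hNm.trans_le (min_le_left _ _))
      rw [Real.dist_eq]
      exact hcoord j
    have h₁ := (dist_le_pi_dist (f (s x)) (f (s y)) (c y)).trans_lt (hδf _ hxS _ hyS hd)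
    rw [Real.dist_eq, abs_lt] at h₁
    have h₂ := abs_le.1 (hcoord (c y))
    have h₃ := hc y hyS
    have := min_le_right δ (ε / 2)
    linarith [h₁.1, h₂.2]

/-- **Brouwer's fixed point theorem** for the standard `n`-simplex. -/
theorem brouwer_fixed_point (n : ℕ) (f : (Fin (n + 1) → ℝ) → (Fin (n + 1) → ℝ))
    (hf : ContinuousOn f (stdSimplex ℝ (Fin (n + 1))))
    (hmaps : Set.MapsTo f (stdSimplex ℝ (Fin (n + 1))) (stdSimplex ℝ (Fin (n + 1)))) :
    ∃ x ∈ stdSimplex ℝ (Fin (n + 1)), f x = x := by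
  let g : (Fin (n + 1) → ℝ) → ℝ := fun x => ∑ i, max (x i - f x i) 0
  have hg : ContinuousOn g (stdSimplex ℝ (Fin (n + 1))) := by
    refine continuousOn_finsetSum _ fun i _ => ContinuousOn.sup (ContinuousOn.sub ?_ ?_) ?_
    · exact (continuous_apply i).continuousOn
    · exact (continuous_apply i).comp_continuousOn hf
    · exact continuousOn_const
  obtain ⟨x₀, hx₀, -⟩ := exists_coord_sub_le hf hmaps one_pos
  obtain ⟨x, hx, hmin⟩ :=
    (isCompact_stdSimplex ℝ (Fin (n + 1))).exists_isMinOn ⟨x₀, hx₀⟩ hg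
  refine ⟨x, hx, ?_⟩
  have hgx : g x ≤ 0 := by
    refine le_of_forall_pos_le_add fun ε hε => ?_
    have hn : (0 : ℝ) < n + 1 := by positivity
    obtain ⟨y, hy, hyε⟩ := exists_coord_sub_le hf hmaps (div_pos hε hn)
    calc g x ≤ g y := hmin hy
      _ ≤ ∑ _i : Fin (n + 1), ε / (n + 1) :=
        Finset.sum_le_sum fun i _ => max_le (hyε i) (div_pos hε hn).le
      _ = 0 + ε := by
        simp only [Finset.sum_const, Finset.card_univ, Fintype.card_fin, nsmul_eq_mul]
        push_cast
        field_simp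
        ring
  have hle : ∀ i, x i ≤ f x i := by
    intro i
    have h := Finset.single_le_sum (f := fun i => max (x i - f x i) 0)
      (fun j _ => le_max_right _ _) (Finset.mem_univ i)
    have := (le_max_left _ _).trans (h.trans hgx)
    linarith
  have heq := (Finset.sum_eq_sum_iff_of_le fun i (_ : i ∈ Finset.univ) => hle i).1
    (by rw [hx.2, (hmaps hx).2])
  exact funext fun i => (heq i (Finset.mem_univ i)).symm
end

section
/- Let {U_α}_{α ∈ S} be a simple open cover of the standard k-simplex Δ indexed by its k+1 vertices (so cl(U_α) ⊆ star(α) for each vertex α). Then ⋂_{α∈S} U_α ≠ ∅. -/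
section Scarf

variable {I X L : Type*} [LinearOrder L]

/-- A finite set `r` is dominant for the family of preorders induced by `f i` if no point is
strictly above the `f i`-minimum of `r` for every `i`. -/
def ScarfDominant (f : I → X → L) (r : Finset X) : Prop :=
  ∀ x, ∃ i, ∀ y ∈ r, f i x ≤ f i y

lemma ScarfDominant.mono {f : I → X → L} {r t : Finset X} (h : ScarfDominant f r)
    (htr : t ⊆ r) : ScarfDominant f t := fun x => by
  obtain ⟨i, hi⟩ := h x
  exact ⟨i, fun y hy => hi y (htr hy)⟩

variable [Fintype I] [DecidableEq X]

/-- In a dominant set with as many points as there are orders, the points are enumerated by the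
orders they minimize. -/
lemma ScarfDominant.exists_minimizers {f : I → X → L} {r : Finset X} (h : ScarfDominant f r)
    (hf : ∀ i, Function.Injective (f i)) (hr : r.card = Fintype.card I) (hne : r.Nonempty) :
    ∃ a : I → X, Function.Injective a ∧ (∀ i, a i ∈ r) ∧ (∀ x ∈ r, ∃ i, a i = x) ∧
      ∀ i, ∀ y ∈ r, f i (a i) ≤ f i y := by
  choose a ha hmin using fun i => r.exists_min_image (f i) hne
  have hsurj : ∀ x ∈ r, ∃ i, a i = x := fun x hx => by
    obtain ⟨i, hi⟩ := h x
    exact ⟨i, hf i (le_antisymm (hmin i x hx) (hi _ (ha i)))⟩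
  refine ⟨a, ?_, ha, hsurj, hmin⟩
  have himg : Finset.univ.image a = r := by
    ext x
    simp only [Finset.mem_image, Finset.mem_univ, true_and]
    exact ⟨fun ⟨i, hi⟩ => hi ▸ ha i, hsurj x⟩
  have : Set.InjOn a (Finset.univ : Finset I) :=
    Finset.card_image_iff.1 (by rw [himg, hr, Finset.card_univ])
  exact fun i j hij => this (by simp) (by simp) hij

/-- The exchange step: a dominant set of full size with one point removed can be completed to a
dominant set by exactly one other point, provided that, for each `l`, some point lies above
the minima of the remaining set in all orders but the one indexed by `l`. -/
lemma ScarfDominant.exists_exchange [Fintype X] {f : I → X → L} {t : Finset X} {x₀ : X}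
    (hf : ∀ i, Function.Injective (f i)) (hx₀ : x₀ ∉ t)
    (h : ScarfDominant f (insert x₀ t)) (hcard : t.card + 1 = Fintype.card I)
    (ht : t.Nonempty)
    (habove : ∀ l, ∃ x, ∀ i, i ≠ l → ∃ y ∈ t, f i y < f i x) :
    ∃ x₁, x₁ ≠ x₀ ∧ ∀ x, (x ∉ t ∧ ScarfDominant f (insert x t)) ↔ x = x₀ ∨ x = x₁ := by
  classical
  obtain ⟨a, hainj, hamem, hasurj, hamin⟩ := h.exists_minimizers hf
    (by rw [Finset.card_insert_of_notMem hx₀, hcard]) (Finset.insert_nonempty _ _)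
  obtain ⟨j, hj⟩ := hasurj x₀ (Finset.mem_insert_self _ _)
  obtain ⟨z, hzt, hzmin⟩ := t.exists_min_image (f j) ht
  obtain ⟨l, hl⟩ := hasurj z (Finset.mem_insert_of_mem hzt)
  have hjl : j ≠ l := by
    rintro rfl
    exact hx₀ (by rw [← hj, hl]; exact hzt)
  have hat : ∀ i, i ≠ j → a i ∈ t := fun i hi =>
    (Finset.mem_insert.1 (hamem i)).resolve_left fun he => hi (hainj (he.trans hj.symm))
  have hatmin : ∀ i, ∀ y ∈ t, f i (a i) ≤ f i y := fun i y hy =>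
    hamin i y (Finset.mem_insert_of_mem hy)
  -- two completions minimizing the same order, and above `t` in the others, coincide
  have huniq : ∀ m x x', (∀ i, i ≠ m → ∃ y ∈ t, f i y < f i x) →
      ScarfDominant f (insert x' t) → f m x' < f m x → False := by
    intro m x x' hx hx' hlt
    obtain ⟨i, hi⟩ := hx' x
    by_cases him : i = m
    · subst him
      exact absurd (hi x' (Finset.mem_insert_self _ _)) (not_le.2 hlt)
    · obtain ⟨y, hy, hyx⟩ := hx i him
      exact absurd (hi y (Finset.mem_insert_of_mem hy)) (not_le.2 hyx)
  have huniq' : ∀ m x x', (∀ i, i ≠ m → ∃ y ∈ t, f i y < f i x) →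
      (∀ i, i ≠ m → ∃ y ∈ t, f i y < f i x') → ScarfDominant f (insert x t) →
      ScarfDominant f (insert x' t) → x = x' := by
    intro m x x' hx hx' hd hd'
    rcases lt_trichotomy (f m x) (f m x') with hlt | heq | hlt
    · exact (huniq m x' x hx' hd hlt).elim
    · exact hf m heq
    · exact (huniq m x x' hx hd' hlt).elim
  have hx₀above : ∀ i, i ≠ j → ∃ y ∈ t, f i y < f i x₀ := fun i hi =>
    ⟨a i, hat i hi, lt_of_le_of_ne (hamin i x₀ (Finset.mem_insert_self _ _))
      fun he => hx₀ (hf i he ▸ hat i hi)⟩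
  let M : Finset X := Finset.univ.filter fun x => ∀ i, i ≠ l → ∃ y ∈ t, f i y < f i x
  have hM : M.Nonempty := by
    obtain ⟨x, hx⟩ := habove l
    exact ⟨x, by simpa [M] using hx⟩
  obtain ⟨x₁, hx₁M, hx₁max⟩ := M.exists_max_image (f l) hM
  have hx₁ : ∀ i, i ≠ l → ∃ y ∈ t, f i y < f i x₁ := by simpa [M] using hx₁M
  have hzx₁ : f j z < f j x₁ := by
    obtain ⟨y, hy, hlt⟩ := hx₁ j hjl
    exact (hzmin y hy).trans_lt hlt
  have hx₁t : x₁ ∉ t := by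
    intro hmem
    obtain ⟨i, hi⟩ := hasurj x₁ (Finset.mem_insert_of_mem hmem)
    by_cases hil : i = l
    · rw [← hi, hil, hl] at hzx₁
      exact lt_irrefl _ hzx₁
    · obtain ⟨y, hy, hlt⟩ := hx₁ i hil
      exact absurd (hatmin i y hy) (not_le.2 (hi ▸ hlt))
  have hx₁dom : ScarfDominant f (insert x₁ t) := by
    intro w
    by_contra! hw
    have hwM : ∀ i, i ≠ l → ∃ y ∈ t, f i y < f i w := by
      intro i hi
      obtain ⟨y, hy, hlt⟩ := hw i
      rcases Finset.mem_insert.1 hy with rfl | hy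
      · obtain ⟨y', hy', hlt'⟩ := hx₁ i hi
        exact ⟨y', hy', hlt'.trans hlt⟩
      · exact ⟨y, hy, hlt⟩
    have hwl : ∃ y ∈ t, f l y < f l w := by
      obtain ⟨y, hy, hlt⟩ := hw l
      rcases Finset.mem_insert.1 hy with rfl | hy
      · exact absurd (hx₁max w (by simpa [M] using hwM)) (not_le.2 hlt)
      · exact ⟨y, hy, hlt⟩
    obtain ⟨i, hi⟩ := h.mono (Finset.subset_insert _ _) w
    by_cases hil : i = l
    · obtain ⟨y, hy, hlt⟩ := hil ▸ hwl
      exact absurd (hi y hy) (not_le.2 (by simpa [hil] using hlt))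
    · obtain ⟨y, hy, hlt⟩ := hwM i hil
      exact absurd (hi y hy) (not_le.2 hlt)
  refine ⟨x₁, ?_, fun x => ⟨?_, ?_⟩⟩
  · rintro rfl
    exact absurd (hamin j z (Finset.mem_insert_of_mem hzt)) (not_le.2 (by rw [hj]; exact hzx₁))
  · rintro ⟨hxt, hdom⟩
    obtain ⟨b, hbinj, hbmem, hbsurj, hbmin⟩ := hdom.exists_minimizers hf
      (by rw [Finset.card_insert_of_notMem hxt, hcard]) (Finset.insert_nonempty _ _)
    obtain ⟨m, hm⟩ := hbsurj x (Finset.mem_insert_self _ _)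
    have hbt : ∀ i, i ≠ m → b i ∈ t := fun i hi =>
      (Finset.mem_insert.1 (hbmem i)).resolve_left fun he => hi (hbinj (he.trans hm.symm))
    have hba : ∀ i, i ≠ m → ∀ y ∈ t, (∀ y' ∈ t, f i y ≤ f i y') → b i = y :=
      fun i hi y hy hymin => hf i (le_antisymm (hbmin i y (Finset.mem_insert_of_mem hy))
        (hymin _ (hbt i hi)))
    have hxabove : ∀ i, i ≠ m → ∃ y ∈ t, f i y < f i x := fun i hi =>
      ⟨b i, hbt i hi, lt_of_le_of_ne (hbmin i x (Finset.mem_insert_self _ _))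
        fun he => hxt (hf i he ▸ hbt i hi)⟩
    by_cases hmj : m = j
    · subst hmj
      exact Or.inl (huniq' m x x₀ hxabove hx₀above hdom h)
    · have hml : m = l := by
        by_contra hml
        have h1 := hba j (Ne.symm hmj) z hzt hzmin
        have h2 := hba l (Ne.symm hml) z hzt (hl ▸ hatmin l)
        exact hjl (hbinj (h1.trans h2.symm))
      subst hml
      exact Or.inr (huniq' m x x₁ hxabove hx₁ hdom hx₁dom)
  · rintro (rfl | rfl)
    · exact ⟨hx₀, h⟩
    · exact ⟨hx₁t, hx₁dom⟩

/-- A set whose colors do not exhaust `I` has an even number of points whose removal leaves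
exactly the colors other than `i₀`. -/
lemma even_card_filter_image_erase [DecidableEq I] (c : X → I) (i₀ : I) {r : Finset X}
    (hr : r.card = Fintype.card I) (hc : r.image c ≠ Finset.univ) :
    Even (r.filter fun y => (r.erase y).image c = Finset.univ.erase i₀).card := by
  rcases (r.filter fun y => (r.erase y).image c = Finset.univ.erase i₀).eq_empty_or_nonempty
    with he | ⟨y, hy⟩
  · simp [he]
  have hinj : ∀ w ∈ r, (r.erase w).image c = Finset.univ.erase i₀ →
      Set.InjOn c (r.erase w) := fun w hw hwc => Finset.card_image_iff.1 (by
    rw [hwc, Finset.card_erase_of_mem hw, hr, Finset.card_erase_of_mem (Finset.mem_univ _),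
      Finset.card_univ])
  obtain ⟨hyr, hyc⟩ := Finset.mem_filter.1 hy
  have himg : r.image c = insert (c y) (Finset.univ.erase i₀) := by
    rw [← hyc, ← Finset.image_insert, Finset.insert_erase hyr]
  have hcy : c y ≠ i₀ := fun he => hc (by
    rw [himg, he, Finset.insert_erase (Finset.mem_univ _)])
  have hmem : c y ∈ (r.erase y).image c := by
    rw [hyc]
    simp [hcy]
  obtain ⟨y', hy', hcy'⟩ := Finset.mem_image.1 hmem
  obtain ⟨hne, hy'r⟩ := Finset.mem_erase.1 hy'
  have hfil : (r.filter fun y => (r.erase y).image c = Finset.univ.erase i₀) = {y, y'} := by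
    ext w
    simp only [Finset.mem_filter, Finset.mem_insert, Finset.mem_singleton]
    constructor
    · rintro ⟨hw, hwc⟩
      by_contra! hcon
      exact hne (hinj w hw hwc (by simp [hy'r, hcon.2.symm]) (by simp [hyr, hcon.1.symm]) hcy')
    · rintro (rfl | rfl)
      · exact ⟨hyr, hyc⟩
      · refine ⟨hy'r, ?_⟩
        rw [← hyc]
        ext i
        simp only [Finset.mem_image, Finset.mem_erase]
        constructor
        · rintro ⟨u, ⟨hu, hur⟩, rfl⟩
          by_cases huy : u = y
          · exact ⟨w, ⟨hne, hy'r⟩, by rw [huy, hcy']⟩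
          · exact ⟨u, ⟨huy, hur⟩, rfl⟩
        · rintro ⟨u, ⟨hu, hur⟩, rfl⟩
          by_cases huy : u = w
          · exact ⟨y, ⟨hne.symm, hyr⟩, by rw [huy, hcy']⟩
          · exact ⟨u, ⟨huy, hur⟩, rfl⟩
  rw [hfil, Finset.card_pair hne.symm]
  exact even_two

/-- Scarf's lemma: for a finite set with a family of linear orders and slack points `s i`, every
coloring with `c (s i) = i` admits a dominant set containing every color exactly once. -/
theorem exists_scarfDominant_image_eq_univ [Fintype X] [DecidableEq I] [Nonempty I]
    (f : I → X → L) (hf : ∀ i, Function.Injective (f i)) (s : I → X)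
    (hs : ∀ i x, f i (s i) ≤ f i x)
    (hs' : ∀ i j x, i ≠ j → x ∉ Set.range s → f i x < f i (s j))
    (hT : ∃ x, x ∉ Set.range s) (c : X → I) (hc : ∀ i, c (s i) = i) :
    ∃ r : Finset X, ScarfDominant f r ∧ r.image c = Finset.univ := by
  classical
  by_contra! hcon
  obtain ⟨i₀⟩ := ‹Nonempty I›
  have hsinj : Function.Injective s := fun i j h => by rw [← hc i, h, hc]
  let R : Finset (Finset X) :=
    Finset.univ.filter fun r => ScarfDominant f r ∧ r.card = Fintype.card I
  let D : Finset (Finset X) := Finset.univ.filter fun t =>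
    t.card + 1 = Fintype.card I ∧ t.image c = Finset.univ.erase i₀
  let t₀ : Finset X := (Finset.univ.erase i₀).image s
  have hrooms : ∀ r ∈ R, Even (D.filter fun t => t ⊆ r).card := by
    intro r hr
    obtain ⟨hdom, hcard⟩ := (Finset.mem_filter.1 hr).2
    have := even_card_filter_image_erase c i₀ hcard (hcon r hdom)
    convert this using 1
    symm
    refine Finset.card_bij (fun y _ => r.erase y) ?_ ?_ ?_
    · intro y hy
      obtain ⟨hyr, hyc⟩ := Finset.mem_filter.1 hy
      simp only [D, Finset.mem_filter, Finset.mem_univ, true_and]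
      exact ⟨⟨by rw [Finset.card_erase_add_one hyr, hcard], hyc⟩, Finset.erase_subset _ _⟩
    · intro y hy y' hy' h
      exact Finset.erase_injOn r (Finset.mem_filter.1 hy).1 (Finset.mem_filter.1 hy').1 h
    · intro t ht
      simp only [D, Finset.mem_filter, Finset.mem_univ, true_and] at ht
      obtain ⟨⟨htc, hti⟩, htr⟩ := ht
      obtain ⟨y, hy⟩ := Finset.card_eq_one.1 (show (r \ t).card = 1 by
        rw [Finset.card_sdiff_of_subset htr]; omega)
      have hyr : y ∈ r \ t := hy ▸ Finset.mem_singleton_self y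
      have het : r.erase y = t := by
        rw [Finset.erase_eq, ← hy, Finset.sdiff_sdiff_eq_self htr]
      exact ⟨y, Finset.mem_filter.2 ⟨(Finset.mem_sdiff.1 hyr).1, by rw [het, hti]⟩, het⟩
  have hdoor : ∀ t ∈ D, (R.filter fun r => t ⊆ r).card =
      (Finset.univ.filter fun x => x ∉ t ∧ ScarfDominant f (insert x t)).card := by
    intro t ht
    obtain ⟨htc, hti⟩ := (Finset.mem_filter.1 ht).2
    symm
    refine Finset.card_bij (fun x _ => insert x t) ?_ ?_ ?_
    · intro x hx
      obtain ⟨hxt, hdom⟩ := (Finset.mem_filter.1 hx).2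
      simp only [R, Finset.mem_filter, Finset.mem_univ, true_and]
      exact ⟨⟨hdom, by rw [Finset.card_insert_of_notMem hxt, htc]⟩, Finset.subset_insert _ _⟩
    · intro x hx x' hx' h
      have : x ∈ insert x' t := by
        rw [← show insert x t = insert x' t from h]
        exact Finset.mem_insert_self _ _
      exact (Finset.mem_insert.1 this).resolve_right (Finset.mem_filter.1 hx).2.1
    · intro r hr
      simp only [R, Finset.mem_filter, Finset.mem_univ, true_and] at hr
      obtain ⟨⟨hdom, hcard⟩, htr⟩ := hr
      obtain ⟨y, hy⟩ := Finset.card_eq_one.1 (show (r \ t).card = 1 by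
        rw [Finset.card_sdiff_of_subset htr]; omega)
      have hyr : y ∈ r \ t := hy ▸ Finset.mem_singleton_self y
      have hins : insert y t = r := by
        rw [Finset.insert_eq, ← hy, Finset.sdiff_union_of_subset htr]
      exact ⟨y, by simp [hins, hdom, (Finset.mem_sdiff.1 hyr).2], hins⟩
  have ht₀D : t₀ ∈ D := by
    simp only [D, t₀, Finset.mem_filter, Finset.mem_univ, true_and]
    refine ⟨?_, ?_⟩
    · rw [Finset.card_image_of_injective _ hsinj, Finset.card_erase_add_one (Finset.mem_univ _),
        Finset.card_univ]
    · rw [Finset.image_image, show c ∘ s = id from funext hc, Finset.image_id]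
  have hslack : ∀ t ∈ D, (∀ y ∈ t, y ∈ Set.range s) → t = t₀ := by
    intro t ht hts
    obtain ⟨htc, hti⟩ := (Finset.mem_filter.1 ht).2
    refine Finset.eq_of_subset_of_card_le (fun y hy => ?_) ?_
    · obtain ⟨i, rfl⟩ := hts y hy
      refine Finset.mem_image_of_mem s ?_
      rw [← hti, ← hc i]
      exact Finset.mem_image_of_mem c hy
    · have := (Finset.mem_filter.1 ht₀D).2.1
      omega
  have hodd : (R.filter fun r => t₀ ⊆ r).card = 1 := by
    rw [hdoor t₀ ht₀D]
    obtain ⟨x, hx, hxmax⟩ := (Finset.univ.filter fun x => x ∉ Set.range s).exists_max_image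
      (f i₀) (by obtain ⟨x, hx⟩ := hT; exact ⟨x, by simpa using hx⟩)
    replace hx : x ∉ Set.range s := (Finset.mem_filter.1 hx).2
    have hxt : x ∉ t₀ := fun h => by
      obtain ⟨i, -, hi⟩ := Finset.mem_image.1 h
      exact hx ⟨i, hi⟩
    rw [Finset.card_eq_one]
    refine ⟨x, ?_⟩
    ext y
    simp only [Finset.mem_filter, Finset.mem_univ, true_and, Finset.mem_singleton]
    constructor
    · rintro ⟨hyt, hdom⟩
      obtain ⟨i, hi⟩ := hdom x
      have hii₀ : i = i₀ := by
        by_contra hne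
        have hsi : s i ∈ t₀ := Finset.mem_image_of_mem s (by simp [hne])
        exact hx ⟨i, hf i (le_antisymm (hs i x) (hi _ (Finset.mem_insert_of_mem hsi)))⟩
      subst hii₀
      have hxy := hi y (Finset.mem_insert_self _ _)
      have hy : y ∉ Set.range s := by
        rintro ⟨j, rfl⟩
        by_cases hji : j = i
        · subst hji
          exact hx ⟨j, hf j (le_antisymm (hs j x) hxy)⟩
        · exact hyt (Finset.mem_image_of_mem s (by simp [hji]))
      exact hf i (le_antisymm (hxmax y (by simpa using hy)) hxy)
    · rintro rfl
      refine ⟨hxt, fun w => ?_⟩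
      by_cases hw : w ∈ Set.range s
      · obtain ⟨i, rfl⟩ := hw
        exact ⟨i, fun v _ => hs i v⟩
      · refine ⟨i₀, fun v hv => ?_⟩
        rcases Finset.mem_insert.1 hv with rfl | hv
        · exact hxmax w (by simpa using hw)
        · obtain ⟨i, hi, rfl⟩ := Finset.mem_image.1 hv
          exact (hs' i₀ i w (Finset.ne_of_mem_erase hi).symm hw).le
  have heven : ∀ t ∈ D, t ≠ t₀ → Even (R.filter fun r => t ⊆ r).card := by
    intro t ht hne
    rw [hdoor t ht]
    obtain ⟨htc, hti⟩ := (Finset.mem_filter.1 ht).2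
    rcases (Finset.univ.filter fun x =>
      x ∉ t ∧ ScarfDominant f (insert x t)).eq_empty_or_nonempty with he | ⟨x₀, hx₀⟩
    · simp [he]
    obtain ⟨hx₀t, hdom⟩ := (Finset.mem_filter.1 hx₀).2
    obtain ⟨y, hyt, hys⟩ : ∃ y ∈ t, y ∉ Set.range s := by
      by_contra! h
      exact hne (hslack t ht h)
    obtain ⟨x₁, hx₁, hiff⟩ := hdom.exists_exchange hf hx₀t htc ⟨y, hyt⟩
      fun l => ⟨s l, fun i hi => ⟨y, hyt, hs' i l y hi hys⟩⟩
    have hpair : (Finset.univ.filter fun x => x ∉ t ∧ ScarfDominant f (insert x t)) =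
        {x₀, x₁} := by
      ext x
      simp [hiff]
    rw [hpair, Finset.card_pair hx₁.symm]
    exact even_two
  have hsum : ∑ r ∈ R, (D.filter fun t => t ⊆ r).card =
      ∑ t ∈ D, (R.filter fun r => t ⊆ r).card :=
    (Finset.sum_card_bipartiteAbove_eq_sum_card_bipartiteBelow (s := D) (t := R)
      (r := fun (t r : Finset X) => t ⊆ r)).symm
  have h1 : Even (∑ r ∈ R, (D.filter fun t => t ⊆ r).card) := Finset.even_sum _ hrooms
  rw [hsum, ← Finset.add_sum_erase D _ ht₀D, hodd] at h1
  have h2 : Even (∑ t ∈ D.erase t₀, (R.filter fun r => t ⊆ r).card) :=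
    Finset.even_sum _ fun t ht =>
      heven t (Finset.mem_of_mem_erase ht) (Finset.ne_of_mem_erase ht)
  obtain ⟨u, hu⟩ := h1
  obtain ⟨v, hv⟩ := h2
  omega

end Scarf

section Simplex

variable {I : Type*} [Fintype I] [DecidableEq I] [Nonempty I]

/-- Any coloring of the lattice points of the dilated simplex has a lattice point `p` such that
for every `i`, either the `i`-th coordinate of `p` is small or a lattice point of color `i` is
close to `p`. -/
lemma exists_latticePoint_near_every_color (N : ℕ)
    (c : {p : I → ℕ // ∑ i, p i = N} → I) :
    ∃ p : {p : I → ℕ // ∑ i, p i = N}, ∀ i, p.1 i ≤ Fintype.card I ∨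
      ∃ q, c q = i ∧ ∀ j, |(q.1 j : ℤ) - p.1 j| ≤ Fintype.card I := by
  classical
  have hfin : Finite {p : I → ℕ // ∑ i, p i = N} := by
    refine Finite.of_injective
      (β := I → Fin (N + 1)) (fun p i => ⟨p.1 i, Nat.lt_succ_of_le ?_⟩) ?_
    · exact (Finset.single_le_sum (f := p.1) (fun _ _ => Nat.zero_le _)
        (Finset.mem_univ i)).trans_eq p.2
    · intro p q h
      ext i
      simpa using congrFun h i
  have := Fintype.ofFinite {p : I → ℕ // ∑ i, p i = N}
  let T := {p : I → ℕ // ∑ i, p i = N}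
  have hple : ∀ (p : T) i, p.1 i ≤ N := fun p i =>
    (Finset.single_le_sum (f := p.1) (fun _ _ => Nat.zero_le _) (Finset.mem_univ i)).trans_eq p.2
  let v : T ⊕ I → I → ℤ := fun x i =>
    Sum.elim (fun p => (p.1 i : ℤ)) (fun j => if i = j then -1 else N + 1) x
  have hvT : ∀ (p : T) i, v (Sum.inl p) i = p.1 i := fun _ _ => rfl
  have hvI : ∀ i j, v (Sum.inr j) i = if i = j then -1 else (N : ℤ) + 1 := fun _ _ => rfl
  have hv : ∀ x i, -1 ≤ v x i := by
    rintro (p | j) i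
    · rw [hvT]; omega
    · rw [hvI]; split_ifs <;> omega
  let e := Fintype.equivFin (T ⊕ I)
  let f : I → T ⊕ I → ℤ ×ₗ Fin (Fintype.card (T ⊕ I)) := fun i x => toLex (v x i, e x)
  have hflt : ∀ i x y, v x i < v y i → f i x < f i y := fun i x y h =>
    Prod.Lex.toLex_lt_toLex.2 (Or.inl h)
  have hfle : ∀ i x y, f i x ≤ f i y → v x i ≤ v y i := fun i x y h =>
    not_lt.1 fun hlt => absurd h (not_le.2 (hflt i y x hlt))
  have hnot : ∀ x, x ∉ Set.range (Sum.inr : I → T ⊕ I) → ∃ p, x = Sum.inl p := by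
    rintro (p | j) h
    · exact ⟨p, rfl⟩
    · exact (h ⟨j, rfl⟩).elim
  obtain ⟨i₁⟩ := id ‹Nonempty I›
  have hTne : Nonempty T := ⟨⟨Pi.single i₁ N, by simp⟩⟩
  obtain ⟨r, hdom, hcol⟩ := exists_scarfDominant_image_eq_univ f
    (fun i x y h => e.injective (congrArg (fun z => (ofLex z).2) h)) Sum.inr
    (by
      rintro i (p | j)
      · refine (hflt i _ _ ?_).le
        rw [hvI, hvT, if_pos rfl]; omega
      · by_cases hij : i = j
        · rw [hij]
        · refine (hflt i _ _ ?_).le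
          rw [hvI, hvI, if_pos rfl, if_neg hij]; omega)
    (by
      intro i j x hij hx
      obtain ⟨p, rfl⟩ := hnot x hx
      refine hflt i _ _ ?_
      rw [hvI, hvT, if_neg hij]
      have := hple p i
      omega)
    ⟨Sum.inl hTne.some, by simp⟩ (Sum.elim c id) (fun _ => rfl)
  have hcol' : ∀ i, ∃ y ∈ r, Sum.elim c id y = i := fun i =>
    Finset.mem_image.1 (by rw [hcol]; exact Finset.mem_univ i)
  have hrne : r.Nonempty := by
    obtain ⟨y, hy, -⟩ := hcol' i₁
    exact ⟨y, hy⟩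
  obtain ⟨p, hp⟩ : ∃ p, Sum.inl p ∈ r := by
    by_contra! hno
    have hall : ∀ i, Sum.inr i ∈ r := by
      intro i
      obtain ⟨y | y, hy, h⟩ := hcol' i
      · exact (hno y hy).elim
      · exact h ▸ hy
    obtain ⟨i, hi⟩ := hdom (Sum.inl hTne.some)
    have := hfle i _ _ (hi _ (hall i))
    rw [hvT, hvI, if_pos rfl] at this
    omega
  choose m hmr hmin using fun i => r.exists_min_image (fun y => v y i) hrne
  have hsum : (N : ℤ) < ∑ i, (v (m i) i + 1) := by
    by_contra! hle
    let d : I → ℕ := fun i => (v (m i) i + 1).toNat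
    have hd : ∀ i, (d i : ℤ) = v (m i) i + 1 := fun i =>
      Int.toNat_of_nonneg (by have := hv (m i) i; omega)
    have hdN : ∑ i, d i ≤ N := by
      have : ((∑ i, d i : ℕ) : ℤ) ≤ N := by
        push_cast
        simpa only [hd] using hle
      exact_mod_cast this
    let q : T := ⟨d + Pi.single i₁ (N - ∑ i, d i), by
      simp only [Pi.add_apply, Finset.sum_add_distrib, Finset.sum_pi_single', Finset.mem_univ,
        if_true]
      omega⟩
    obtain ⟨i, hi⟩ := hdom (Sum.inl q)
    have h1 := hfle i _ _ (hi _ (hmr i))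
    have h2 : d i ≤ q.1 i := Nat.le_add_right _ _
    have h3 := hd i
    rw [hvT] at h1
    omega
  have hnear : ∀ q : T, Sum.inl q ∈ r → ∀ i,
      v (m i) i ≤ q.1 i ∧ (q.1 i : ℤ) ≤ v (m i) i + Fintype.card I := by
    intro q hq i
    have hle : ∀ i, v (m i) i ≤ q.1 i := fun i => hmin i _ hq
    refine ⟨hle i, ?_⟩
    have h1 : (q.1 i : ℤ) - v (m i) i ≤ ∑ i, ((q.1 i : ℤ) - v (m i) i) :=
      Finset.single_le_sum (f := fun i => (q.1 i : ℤ) - v (m i) i)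
        (fun i _ => sub_nonneg.2 (hle i)) (Finset.mem_univ i)
    have h2 : ∑ i, (q.1 i : ℤ) = N := by exact_mod_cast q.2
    rw [Finset.sum_sub_distrib, h2] at h1
    rw [Finset.sum_add_distrib] at hsum
    simp only [Finset.sum_const, Finset.card_univ, nsmul_eq_mul, mul_one] at hsum
    linarith
  refine ⟨p, fun i => ?_⟩
  obtain ⟨q | j, hq, hqi⟩ := hcol' i
  · refine Or.inr ⟨q, hqi, fun j => ?_⟩
    have h1 := hnear q hq j
    have h2 := hnear p hp j
    rw [abs_le]
    constructor <;> linarith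
  · left
    obtain rfl : j = i := hqi
    have h1 := hmin j _ hq
    have h2 := (hnear p hp j).2
    simp only [hvI, if_true] at h1
    omega

/-- The dual form of the KKM theorem: closed sets covering the simplex, the `i`-th of which
contains the facet opposite to the vertex `i`, have a common point. -/
theorem nonempty_iInter_of_isClosed_of_facet_subset (F : I → Set (stdSimplex ℝ I))
    (hclosed : ∀ i, IsClosed (F i)) (hcover : ∀ x, ∃ i, x ∈ F i)
    (hfacet : ∀ i (x : stdSimplex ℝ I), (x : I → ℝ) i = 0 → x ∈ F i) :
    (⋂ i, F i).Nonempty := by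
  choose c hc using hcover
  have hseq : ∀ n : ℕ, ∃ x : stdSimplex ℝ I, ∀ i,
      (x : I → ℝ) i ≤ Fintype.card I / ((n : ℝ) + 1) ∨
        ∃ z ∈ F i, dist z x ≤ Fintype.card I / ((n : ℝ) + 1) := by
    intro n
    have hn : (0 : ℝ) < n + 1 := by positivity
    let g : {p : I → ℕ // ∑ i, p i = n + 1} → stdSimplex ℝ I := fun p =>
      ⟨fun i => p.1 i / ((n : ℝ) + 1), fun i => by positivity, by
        rw [← Finset.sum_div, ← Nat.cast_sum, p.2]
        push_cast
        exact div_self hn.ne'⟩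
    obtain ⟨p, hp⟩ := exists_latticePoint_near_every_color (n + 1) (c ∘ g)
    refine ⟨g p, fun i => ?_⟩
    rcases hp i with h | ⟨q, rfl, hq⟩
    · left
      have : (p.1 i : ℝ) ≤ Fintype.card I := by exact_mod_cast h
      exact div_le_div_of_nonneg_right this hn.le
    · refine Or.inr ⟨g q, hc _, ?_⟩
      rw [Subtype.dist_eq, dist_pi_le_iff (by positivity)]
      intro j
      have : |(q.1 j : ℝ) - p.1 j| ≤ Fintype.card I := by exact_mod_cast hq j
      change dist ((q.1 j : ℝ) / ((n : ℝ) + 1)) ((p.1 j : ℝ) / ((n : ℝ) + 1)) ≤ _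
      rw [Real.dist_eq, ← sub_div, abs_div, abs_of_pos hn]
      exact div_le_div_of_nonneg_right this hn.le
  choose u hu using hseq
  have : CompactSpace (stdSimplex ℝ I) := isCompact_iff_compactSpace.1 (isCompact_stdSimplex ℝ I)
  obtain ⟨x, φ, hφ, hlim⟩ := CompactSpace.tendsto_subseq u
  have hsmall : Filter.Tendsto (fun n => (Fintype.card I : ℝ) / ((φ n : ℝ) + 1)) Filter.atTop
      (nhds 0) :=
    (tendsto_const_nhds.div_atTop (Filter.tendsto_atTop_add_const_right _ _
      tendsto_natCast_atTop_atTop)).comp hφ.tendsto_atTop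
  refine ⟨x, Set.mem_iInter.2 fun i => ?_⟩
  by_contra hx
  have hpos : 0 < (x : I → ℝ) i :=
    lt_of_le_of_ne (x.2.1 i) fun h => hx (hfacet i x h.symm)
  obtain ⟨ε, hε, hball⟩ := Metric.isOpen_iff.1 (hclosed i).isOpen_compl x hx
  have hcoord : Filter.Tendsto (fun n => (u (φ n) : I → ℝ) i) Filter.atTop
      (nhds ((x : I → ℝ) i)) :=
    (((continuous_apply i).comp continuous_subtype_val).tendsto x).comp hlim
  obtain ⟨n, h1, h2, h3⟩ := ((hsmall.eventually_lt hcoord hpos).and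
    ((hsmall.eventually_lt_const (half_pos hε)).and
      (Metric.tendsto_nhds.1 hlim _ (half_pos hε)))).exists
  rcases hu (φ n) i with h | ⟨z, hz, hzu⟩
  · exact absurd h (not_le.2 h1)
  · refine hball (Metric.mem_ball.2 ?_) hz
    calc dist z x ≤ dist z (u (φ n)) + dist (u (φ n)) x := dist_triangle _ _ _
      _ < ε / 2 + ε / 2 := add_lt_add (hzu.trans_lt h2) h3
      _ = ε := add_halves ε

end Simplex

/-- Extension of the KKM theorem to simple covers: a simple open cover of the standard
`k`-simplex indexed by its `k + 1` vertices has a common point.  Here the open star of the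
vertex `i` is the set of points of the simplex whose `i`-th barycentric coordinate is
positive. -/
theorem kkm_simple_cover (k : ℕ) (U : Fin (k + 1) → Set ↥(stdSimplex ℝ (Fin (k + 1))))
    (hopen : ∀ i, IsOpen (U i))
    (hcover : (⋃ i, U i) = Set.univ)
    (hsimple : ∀ i, closure (U i) ⊆
      {x : ↥(stdSimplex ℝ (Fin (k + 1))) | 0 < (x : Fin (k + 1) → ℝ) i}) :
    (⋂ i, U i).Nonempty := by
  by_contra hempty
  obtain ⟨x, hx⟩ := nonempty_iInter_of_isClosed_of_facet_subset (fun i => (U i)ᶜ)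
    (fun i => (hopen i).isClosed_compl)
    (fun x => by
      by_contra! h
      exact hempty ⟨x, Set.mem_iInter.2 fun i => not_not.1 (h i)⟩)
    (fun i x hxi hxU => (hsimple i (subset_closure hxU)).ne' hxi)
  obtain ⟨i, hi⟩ := Set.mem_iUnion.1 (hcover ▸ Set.mem_univ x)
  exact Set.mem_iInter.1 hx i hi
end
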